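/- arXiv:2105.05315 — 2 statements merged into one kernel-verified Lean document; each statement's English description precedes it below -/
import Mathlib

section
/- Let D be a relativizable generalized dependency such that both D and ∼D are strongly first order, and let 𝔐 = (M,R) ∈ D with M countable. Then there exists a first-order sentence η_𝔐 of the form ψ ∧ ⋀_{i=1}^{n} ∃ȳᵢ ∀x̄ (R x̄ → θᵢ(x̄, ȳᵢ)) ∧ ⋀_{j=1}^{n'} ¬∃z̄ⱼ ∀x̄ (R x̄ → ξⱼ(x̄, z̄ⱼ)), where ψ is a first-order sentence over the empty signature and all θᵢ and ξⱼ are first-order formulas over the empty signature, such that (1) 𝔐 ⊨ η_𝔐, and (2) η_𝔐 ⊨ D(R), i.e., every model of η_𝔐 belongs to D. -/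
namespace DSFO

/-- A purely relational signature: for each arity, a type of relation symbols. -/
abbrev Signature := ℕ → Type

/-- The empty signature. -/
def Sig0 : Signature := fun _ => Empty

/-- The signature with a single `k`-ary relation symbol `R`. -/
def SigR (k : ℕ) : Signature := fun n => PLift (n = k)

/-- Syntax of team-semantics formulas (in negation normal form, with the two
additional connectives: global disjunction `gdisj` and contradictory negation
`cneg`) over a relational signature `S`, with generalized dependency atoms
indexed by `ι` with arities `ar`.  Variables are natural numbers. -/
inductive TS (S : Signature) (ι : Type) (ar : ι → ℕ) : Type
  | rel {k : ℕ} (r : S k) (v : Fin k → ℕ)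
  | nrel {k : ℕ} (r : S k) (v : Fin k → ℕ)
  | eq (x y : ℕ)
  | neq (x y : ℕ)
  | dep (i : ι) (v : Fin (ar i) → ℕ)
  | and (φ ψ : TS S ι ar)
  | or (φ ψ : TS S ι ar)
  | gdisj (φ ψ : TS S ι ar)
  | cneg (φ : TS S ι ar)
  | ex (v : ℕ) (φ : TS S ι ar)
  | al (v : ℕ) (φ : TS S ι ar)

/-- The always-true literal `⊤`. -/
def TS.top {S : Signature} {ι : Type} {ar : ι → ℕ} : TS S ι ar := .eq 0 0

/-- The arity function for "no dependency atoms". -/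
def noAtoms : Empty → ℕ := fun e => e.elim

/-- First-order formulas over `S` (no dependency atoms; here `cneg` plays the
role of ordinary classical negation and `gdisj` of ordinary disjunction, so
this is full first-order logic). -/
abbrev FOF (S : Signature) := TS S Empty noAtoms

/-- First-order formulas over the empty signature. -/
abbrev EF := FOF Sig0

/-- Free variables of a formula. -/
def fv {S : Signature} {ι : Type} {ar : ι → ℕ} : TS S ι ar → Set ℕ
  | .rel _ v => Set.range v
  | .nrel _ v => Set.range v
  | .eq x y => {x, y}
  | .neq x y => {x, y}
  | .dep _ v => Set.range v
  | .and φ ψ => fv φ ∪ fv ψ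
  | .or φ ψ => fv φ ∪ fv ψ
  | .gdisj φ ψ => fv φ ∪ fv ψ
  | .cneg φ => fv φ
  | .ex v φ => fv φ \ {v}
  | .al v φ => fv φ \ {v}

/-- A sentence is a formula with no free variables. -/
def IsSentence {S : Signature} {ι : Type} {ar : ι → ℕ} (φ : TS S ι ar) : Prop :=
  fv φ = ∅

/-- No global disjunctions occur. -/
def NoGdisj {S : Signature} {ι : Type} {ar : ι → ℕ} : TS S ι ar → Prop
  | .rel _ _ => True
  | .nrel _ _ => True
  | .eq _ _ => True
  | .neq _ _ => True
  | .dep _ _ => True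
  | .and φ ψ => NoGdisj φ ∧ NoGdisj ψ
  | .or φ ψ => NoGdisj φ ∧ NoGdisj ψ
  | .gdisj _ _ => False
  | .cneg φ => NoGdisj φ
  | .ex _ φ => NoGdisj φ
  | .al _ φ => NoGdisj φ

/-- No contradictory negations occur. -/
def NoCneg {S : Signature} {ι : Type} {ar : ι → ℕ} : TS S ι ar → Prop
  | .rel _ _ => True
  | .nrel _ _ => True
  | .eq _ _ => True
  | .neq _ _ => True
  | .dep _ _ => True
  | .and φ ψ => NoCneg φ ∧ NoCneg ψ
  | .or φ ψ => NoCneg φ ∧ NoCneg ψ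
  | .gdisj φ ψ => NoCneg φ ∧ NoCneg ψ
  | .cneg _ => False
  | .ex _ φ => NoCneg φ
  | .al _ φ => NoCneg φ

/-- Formulas of `FO(𝒟)` proper: no `gdisj` and no `cneg`. -/
def Plain {S : Signature} {ι : Type} {ar : ι → ℕ} (φ : TS S ι ar) : Prop :=
  NoCneg φ ∧ NoGdisj φ

/-- Atomic formulas: first-order literals and dependency atoms. -/
def Atomic {S : Signature} {ι : Type} {ar : ι → ℕ} : TS S ι ar → Prop
  | .rel _ _ => True
  | .nrel _ _ => True
  | .eq _ _ => True
  | .neq _ _ => True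
  | .dep _ _ => True
  | _ => False

/-- Formulas of `FO(∼₀, 𝒟)`: the contradictory negation may appear only in
front of first-order literals and dependency atoms (and there is no `gdisj`). -/
def Cneg0 {S : Signature} {ι : Type} {ar : ι → ℕ} : TS S ι ar → Prop
  | .rel _ _ => True
  | .nrel _ _ => True
  | .eq _ _ => True
  | .neq _ _ => True
  | .dep _ _ => True
  | .and φ ψ => Cneg0 φ ∧ Cneg0 ψ
  | .or φ ψ => Cneg0 φ ∧ Cneg0 ψ
  | .gdisj _ _ => False
  | .cneg φ => Atomic φ
  | .ex _ φ => Cneg0 φ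
  | .al _ φ => Cneg0 φ

/-- The negation normal form of the (dual) negation of a formula. -/
def TS.nneg {S : Signature} {ι : Type} {ar : ι → ℕ} : TS S ι ar → TS S ι ar
  | .rel r v => .nrel r v
  | .nrel r v => .rel r v
  | .eq x y => .neq x y
  | .neq x y => .eq x y
  | .dep i v => .cneg (.dep i v)
  | .and φ ψ => .or (TS.nneg φ) (TS.nneg ψ)
  | .or φ ψ => .and (TS.nneg φ) (TS.nneg ψ)
  | .gdisj φ ψ => .and (TS.nneg φ) (TS.nneg ψ)
  | .cneg φ => φ
  | .ex v φ => .al v (TS.nneg φ)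
  | .al v φ => .ex v (TS.nneg φ)

/-- Iterated existential quantification over a list of variables. -/
def exs {S : Signature} {ι : Type} {ar : ι → ℕ} (l : List ℕ) (φ : TS S ι ar) :
    TS S ι ar := l.foldr TS.ex φ

/-- An interpretation of a relational signature in a domain `M`. -/
abbrev Interp (S : Signature) (M : Type) := ∀ k, S k → Set (Fin k → M)

/-- The unique interpretation of the empty signature. -/
def eI (M : Type) : Interp Sig0 M := fun _ e => e.elim

/-- The interpretation of `SigR k` given by a `k`-ary relation `R`. -/
def interpR {k : ℕ} {M : Type} (R : Set (Fin k → M)) : Interp (SigR k) M :=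
  fun _ r => {s | (fun i => s (Fin.cast r.down.symm i)) ∈ R}

/-- Tarskian (single-assignment) satisfaction.  Dependency atoms are
(vacuously) interpreted as true; this is only used on first-order formulas. -/
def FSat {S : Signature} {ι : Type} {ar : ι → ℕ} (M : Type) (I : Interp S M) :
    (ℕ → M) → TS S ι ar → Prop
  | s, .rel r v => (fun i => s (v i)) ∈ I _ r
  | s, .nrel r v => (fun i => s (v i)) ∉ I _ r
  | s, .eq x y => s x = s y
  | s, .neq x y => s x ≠ s y
  | _, .dep _ _ => True
  | s, .and φ ψ => FSat M I s φ ∧ FSat M I s ψ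
  | s, .or φ ψ => FSat M I s φ ∨ FSat M I s ψ
  | s, .gdisj φ ψ => FSat M I s φ ∨ FSat M I s ψ
  | s, .cneg φ => ¬ FSat M I s φ
  | s, .ex v φ => ∃ m : M, FSat M I (Function.update s v m) φ
  | s, .al v φ => ∀ m : M, FSat M I (Function.update s v m) φ

/-- Truth of a first-order sentence (Tarskian semantics). -/
def FOTrue {S : Signature} {ι : Type} {ar : ι → ℕ} (M : Type) (I : Interp S M)
    (φ : TS S ι ar) : Prop :=
  ∀ s : ℕ → M, FSat M I s φ

/-- The relation `X(x̄)` determined by a team `X` and a tuple of variables `x̄`. -/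
def teamProj {M : Type} {k : ℕ} (v : Fin k → ℕ) (X : Set (ℕ → M)) :
    Set (Fin k → M) := {t | ∃ s ∈ X, t = fun j => s (v j)}

/-- (Lax) team semantics.  `A` gives the semantics of each dependency atom as a
function of the relation `X(x̄)`. -/
def TSat {S : Signature} {ι : Type} {ar : ι → ℕ} (M : Type) (I : Interp S M)
    (A : ∀ i, Set (Fin (ar i) → M) → Prop) :
    TS S ι ar → Set (ℕ → M) → Prop
  | .rel r v, X => ∀ s ∈ X, (fun i => s (v i)) ∈ I _ r
  | .nrel r v, X => ∀ s ∈ X, (fun i => s (v i)) ∉ I _ r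
  | .eq x y, X => ∀ s ∈ X, s x = s y
  | .neq x y, X => ∀ s ∈ X, s x ≠ s y
  | .dep i v, X => A i (teamProj v X)
  | .and φ ψ, X => TSat M I A φ X ∧ TSat M I A ψ X
  | .or φ ψ, X => ∃ Y Z : Set (ℕ → M), Y ∪ Z = X ∧ TSat M I A φ Y ∧ TSat M I A ψ Z
  | .gdisj φ ψ, X => TSat M I A φ X ∨ TSat M I A ψ X
  | .cneg φ, X => ¬ TSat M I A φ X
  | .ex v φ, X => ∃ H : (ℕ → M) → Set M, (∀ s ∈ X, (H s).Nonempty) ∧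
      TSat M I A φ {s' | ∃ s ∈ X, ∃ m ∈ H s, s' = Function.update s v m}
  | .al v φ, X => TSat M I A φ {s' | ∃ s ∈ X, ∃ m : M, s' = Function.update s v m}

/-- Truth of a sentence under team semantics: satisfaction by the team of all
assignments (by locality, equivalent to satisfaction by `{∅}`). -/
def TTrue {S : Signature} {ι : Type} {ar : ι → ℕ} (M : Type) (I : Interp S M)
    (A : ∀ i, Set (Fin (ar i) → M) → Prop) (φ : TS S ι ar) : Prop :=
  TSat M I A φ Set.univ

/-- A `k`-ary dependency predicate: a class of pairs `(M, R)`. -/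
abbrev DepPred (k : ℕ) := ∀ M : Type, Set (Fin k → M) → Prop

/-- Closure under isomorphisms (part of the definition of a generalized
dependency). -/
def IsoClosed {k : ℕ} (D : DepPred k) : Prop :=
  ∀ (M N : Type) (e : M ≃ N) (R : Set (Fin k → M)),
    D M R → D N ((fun f => e ∘ f) '' R)

/-- The complement `∼D` of a dependency. -/
def complD {k : ℕ} (D : DepPred k) : DepPred k := fun M R => ¬ D M R

def DownwardsClosed {k : ℕ} (D : DepPred k) : Prop :=
  ∀ (M : Type) (R R' : Set (Fin k → M)), D M R → R' ⊆ R → D M R'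

/-- The downwards closure `D↓`. -/
def dClosure {k : ℕ} (D : DepPred k) : DepPred k :=
  fun M R => ∃ R', R ⊆ R' ∧ D M R'

/-- `D_max`: the maximal models of `D`. -/
def DMax {k : ℕ} (D : DepPred k) : DepPred k :=
  fun M R => D M R ∧ ∀ R', R ⊂ R' → ¬ D M R'

/-- The empty team property. -/
def EmptyTeamProp {k : ℕ} (D : DepPred k) : Prop :=
  ∀ M : Type, Nontrivial M → D M (∅ : Set (Fin k → M))

/-- `D` is a first-order dependency: it is the class of models of a first-order
sentence over the signature `{R}`. -/
def FirstOrderDep {k : ℕ} (D : DepPred k) : Prop :=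
  ∃ ψ : FOF (SigR k), IsSentence ψ ∧
    ∀ (M : Type), Nontrivial M → ∀ R : Set (Fin k → M),
      (D M R ↔ FOTrue M (interpR R) ψ)

/-- The interpretation of a unary predicate symbol as a subset of the domain. -/
def PSet {S : Signature} {M : Type} (I : Interp S M) (P : S 1) : Set M :=
  {m | (fun _ => m) ∈ I 1 P}

/-- Semantics of the relativization `D^(P)` of `D` to the unary predicate `P`:
`𝔐 ⊨_X D^(P) x̄` iff `(P^𝔐, X(x̄)) ∈ D`. -/
def relSem {k : ℕ} (D : DepPred k) {S : Signature} (P : S 1)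
    (M : Type) (I : Interp S M) (R : Set (Fin k → M)) : Prop :=
  (∀ f ∈ R, ∀ j, f j ∈ PSet I P) ∧
    D (↥(PSet I P)) {g : Fin k → ↥(PSet I P) | (fun j => (g j : M)) ∈ R}

/-- A family `𝒟` of generalized dependencies is strongly first order: every
sentence of `FO(𝒟)` is equivalent to some first-order sentence. -/
def SFOFam {ι : Type} {ar : ι → ℕ} (D : ∀ i, DepPred (ar i)) : Prop :=
  ∀ (S : Signature) (φ : TS S ι ar), IsSentence φ → Plain φ →
    ∃ ψ : FOF S, IsSentence ψ ∧
      ∀ (M : Type), Nontrivial M → ∀ I : Interp S M,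
        (TTrue M I (fun i => D i M) φ ↔ FOTrue M I ψ)

/-- A single dependency is strongly first order iff `{D}` is. -/
def SFOd {k : ℕ} (D : DepPred k) : Prop :=
  SFOFam (ι := Unit) (ar := fun _ => k) (fun _ => D)

/-- A family `𝒟` is relativizable: every sentence of `FO(𝒟^(P))` is equivalent
to some sentence of `FO(𝒟)`. -/
def RelativizableFam {ι : Type} {ar : ι → ℕ} (D : ∀ i, DepPred (ar i)) : Prop :=
  ∀ (S : Signature) (P : S 1) (φ : TS S ι ar), IsSentence φ → Plain φ →
    ∃ ψ : TS S ι ar, IsSentence ψ ∧ Plain ψ ∧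
      ∀ (M : Type), Nontrivial M → ∀ I : Interp S M,
        (TTrue M I (fun i => relSem (D i) P M I) φ ↔ TTrue M I (fun i => D i M) ψ)

def Relativizable1 {k : ℕ} (D : DepPred k) : Prop :=
  RelativizableFam (ι := Unit) (ar := fun _ => k) (fun _ => D)

/-- The family `𝒟 ∪ ∼𝒟`. -/
def withComplFam {ι : Type} {ar : ι → ℕ} (D : ∀ i, DepPred (ar i)) :
    ∀ i : ι ⊕ ι, DepPred (Sum.elim ar ar i) :=
  fun i => match i with
    | .inl a => D a
    | .inr a => complD (D a)

/-- `D` is doubly strongly first order: `{D, ∼D}` is strongly first order. -/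
def DSFOd {k : ℕ} (D : DepPred k) : Prop :=
  SFOFam (ι := Bool) (ar := fun _ => k)
    (fun b => match b with | true => D | false => complD D)

/-- The constancy atom of arity `k`. -/
def constD (k : ℕ) : DepPred k := fun _ R => ∀ f ∈ R, ∀ g ∈ R, f = g

/-- The totality atom of arity `k`. -/
def allD (k : ℕ) : DepPred k := fun M R => R = (Set.univ : Set (Fin k → M))

/-- The family `𝒟 ∪ {const}` (constancy atoms of every arity). -/
def withConst {ι : Type} {ar : ι → ℕ} (D : ∀ i, DepPred (ar i)) :
    ∀ i : ι ⊕ ℕ, DepPred (Sum.elim ar id i) :=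
  fun i => match i with
    | .inl a => D a
    | .inr n => constD n

/-- The atoms of `𝒟^(P) ∪ {const}`. -/
def withConstRel {ι : Type} {ar : ι → ℕ} (D : ∀ i, DepPred (ar i))
    {S : Signature} (P : S 1) (M : Type) (I : Interp S M) :
    ∀ i : ι ⊕ ℕ, Set (Fin (Sum.elim ar id i) → M) → Prop :=
  fun i => match i with
    | .inl a => relSem (D a) P M I
    | .inr n => constD n M

/-- Atom indices of the logic `FO(𝒟₀, ⊔, const, All)`: the 0-ary first-order
dependencies `[ψ]`, the constancy atoms and the totality atoms. -/
inductive CIdx : Type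
  | d0 (ψ : EF) (hψ : IsSentence ψ)
  | const (k : ℕ)
  | total (k : ℕ)

def cAr : CIdx → ℕ
  | .d0 _ _ => 0
  | .const k => k
  | .total k => k

def cSem (M : Type) : ∀ i : CIdx, Set (Fin (cAr i) → M) → Prop
  | .d0 ψ _, _ => FOTrue M (eI M) ψ
  | .const _, R => ∀ f ∈ R, ∀ g ∈ R, f = g
  | .total _, R => R = Set.univ

/-- Embedding of first-order formulas over the empty signature into any
team logic. -/
def embedEF {S : Signature} {ι : Type} {ar : ι → ℕ} : EF → TS S ι ar
  | .rel r _ => Empty.elim r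
  | .nrel r _ => Empty.elim r
  | .eq x y => .eq x y
  | .neq x y => .neq x y
  | .dep i _ => Empty.elim i
  | .and φ ψ => .and (embedEF φ) (embedEF ψ)
  | .or φ ψ => .or (embedEF φ) (embedEF ψ)
  | .gdisj φ ψ => .gdisj (embedEF φ) (embedEF ψ)
  | .cneg φ => .cneg (embedEF φ)
  | .ex v φ => .ex v (embedEF φ)
  | .al v φ => .al v (embedEF φ)

/-- Override the values of the variables `0, …, k-1` by the tuple `f`. -/
def overrideFin {M : Type} (k : ℕ) (f : Fin k → M) (s : ℕ → M) : ℕ → M :=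
  fun v => if h : v < k then f ⟨v, h⟩ else s v

/-- `(M, R) ⊨ ∃ȳ ∀x̄ (R x̄ → θ(x̄, ȳ))`, where `x̄` is the tuple of variables
`0, …, k-1` and the remaining free variables `ȳ` of `θ` are witnessed by `s`. -/
def ExAllSem {k : ℕ} (M : Type) (R : Set (Fin k → M)) (θ : EF) : Prop :=
  ∃ s : ℕ → M, ∀ f ∈ R, FSat M (eI M) (overrideFin k f s) θ

/-- `(M, R) ⊨ ∃ȳ ∀x̄ (R x̄ ↔ θ(x̄, ȳ))`. -/
def ExAllIffSem {k : ℕ} (M : Type) (R : Set (Fin k → M)) (θ : EF) : Prop :=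
  ∃ s : ℕ → M, ∀ f : Fin k → M, (f ∈ R ↔ FSat M (eI M) (overrideFin k f s) θ)

/-- The assignment sending `x̄ = (0, …, k-1)` to `f`, `ȳ = (k, …, k+n-1)` to
`a`, and every other variable to its value under `s0`. -/
def tupAsg {M : Type} (k n : ℕ) (f : Fin k → M) (a : Fin n → M) (s0 : ℕ → M) :
    ℕ → M :=
  fun v => if h : v < k then f ⟨v, h⟩ else if h2 : v - k < n then a ⟨v - k, h2⟩ else s0 v

/-- `R` is defined by the formula `θ(x̄, ȳ)` (with `x̄ = (0, …, k-1)` and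
`ȳ = (k, …, k+n-1)`): there is a tuple `ā` of parameters such that
`R = {m̄ : 𝔐 ⊨ θ(m̄, ā)}`. -/
def DefinedBy {S : Signature} {M : Type} (I : Interp S M) (k n : ℕ)
    (θ : FOF S) (R : Set (Fin k → M)) : Prop :=
  ∃ a : Fin n → M, ∀ s0 : ℕ → M, R = {f | FSat M I (tupAsg k n f a s0) θ}

/-- `θ(x̄, ȳ)` fixes the identity type of `ȳ = (k, …, k+n-1)`. -/
def FixesIdType {S : Signature} (k n : ℕ) (θ : FOF S) : Prop :=
  ∀ i j : Fin n,
    (∀ (M : Type), Nontrivial M → ∀ (I : Interp S M) (s : ℕ → M),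
        FSat M I s θ → s (k + (i : ℕ)) = s (k + (j : ℕ))) ∨
    (∀ (M : Type), Nontrivial M → ∀ (I : Interp S M) (s : ℕ → M),
        FSat M I s θ → s (k + (i : ℕ)) ≠ s (k + (j : ℕ)))

/-- `(M, R := Xv) ⊨ ∃ȳ ∀x̄ (R x̄ → θ(x̄, ȳ))` where the `x̄`-slots of `θ` are the
variables `v̄` and the `ȳ`-slots are the variables `ȳ`. -/
def projExAll {M : Type} {k n : ℕ} (v : Fin k → ℕ) (y : Fin n → ℕ) (θ : EF)
    (Xv : Set (Fin k → M)) : Prop :=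
  ∃ b : Fin n → M, ∀ f ∈ Xv, ∀ s : ℕ → M,
    (∀ j, s (v j) = f j) → (∀ i, s (y i) = b i) → FSat M (eI M) s θ

open Filter

local notation "𝓤" => (hyperfilter ℕ : Filter ℕ)

/-! ### Countable limits along an ultrafilter -/


theorem FSat_congr {S : Signature} {ι : Type} {ar : ι → ℕ} {M : Type} (I : Interp S M)
    (φ : TS S ι ar) (s t : ℕ → M) (h : ∀ v ∈ fv φ, s v = t v) :
    FSat M I s φ ↔ FSat M I t φ := by
  induction φ generalizing s t with
  | rel r v =>
    have : (fun i => s (v i)) = fun i => t (v i) := funext fun i => h _ ⟨i, rfl⟩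
    simp [FSat, this]
  | nrel r v =>
    have : (fun i => s (v i)) = fun i => t (v i) := funext fun i => h _ ⟨i, rfl⟩
    simp [FSat, this]
  | eq x y => simp [FSat, h x (by simp [fv]), h y (by simp [fv])]
  | neq x y => simp [FSat, h x (by simp [fv]), h y (by simp [fv])]
  | dep i v => simp [FSat]
  | and φ ψ h1 h2 | or φ ψ h1 h2 | gdisj φ ψ h1 h2 =>
    simp only [FSat]
    rw [h1 s t fun v hv => h v (Or.inl hv), h2 s t fun v hv => h v (Or.inr hv)]
  | cneg φ h1 => simp only [FSat]; rw [h1 s t h]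
  | ex v φ h1 =>
    simp only [FSat]
    refine exists_congr fun m => h1 _ _ fun w hw => ?_
    by_cases hwv : w = v
    · simp [hwv]
    · simp [Function.update_of_ne hwv, h w ⟨hw, hwv⟩]
  | al v φ h1 =>
    simp only [FSat]
    refine forall_congr' fun m => h1 _ _ fun w hw => ?_
    by_cases hwv : w = v
    · simp [hwv]
    · simp [Function.update_of_ne hwv, h w ⟨hw, hwv⟩]

theorem fv_bddAbove {S : Signature} {ι : Type} {ar : ι → ℕ} (φ : TS S ι ar) :
    BddAbove (fv φ) := by
  induction φ with
  | rel r v | nrel r v | dep i v => exact (Set.finite_range v).bddAbove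
  | eq x y | neq x y => exact (Set.toFinite ({x, y} : Set ℕ)).bddAbove
  | and φ ψ h1 h2 | or φ ψ h1 h2 | gdisj φ ψ h1 h2 => exact h1.union h2
  | cneg φ h1 => exact h1
  | ex v φ h1 | al v φ h1 => exact h1.mono Set.sdiff_subset

theorem FOTrue_iff_FSat {S : Signature} {ι : Type} {ar : ι → ℕ} {M : Type} (I : Interp S M)
    {φ : TS S ι ar} (hφ : IsSentence φ) (s : ℕ → M) : FOTrue M I φ ↔ FSat M I s φ :=
  ⟨fun h => h s, fun h t => (FSat_congr I φ t s (by rw [hφ]; simp)).2 h⟩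

/-- `e` names, by sequences, the elements of a substructure of an ultraproduct of the `N n`
which is closed under all operations in `𝒢`. -/
structure IsLimit {N : ℕ → Type} {A : Type} (𝒢 : Set (List (∀ n, N n) → ∀ n, N n))
    (e : A → ∀ n, N n) : Prop where
  inj : ∀ a b, (∀ᶠ n in 𝓤, e a n = e b n) → a = b
  closed : ∀ g ∈ 𝒢, ∀ l : List A, ∃ a, ∀ᶠ n in 𝓤, e a n = g (l.map e) n

theorem IsLimit.mono {N : ℕ → Type} {A : Type} {𝒢 ℋ : Set (List (∀ n, N n) → ∀ n, N n)}
    {e : A → ∀ n, N n} (h : IsLimit ℋ e) (hs : 𝒢 ⊆ ℋ) : IsLimit 𝒢 e :=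
  ⟨h.inj, fun g hg => h.closed g (hs hg)⟩

open Classical in
/-- A Skolem operation for the predicates `P n`. -/
noncomputable def skolem {N : ℕ → Type} [∀ n, Nonempty (N n)]
    (P : ∀ n, (ℕ → N n) → N n → Prop) (l : List (∀ n, N n)) (n : ℕ) : N n :=
  Classical.epsilon (P n fun i => l.getD i (fun _ => Classical.arbitrary _) n)

theorem IsLimit.exists_skolem {N : ℕ → Type} [∀ n, Nonempty (N n)] {A : Type}
    {𝒢 : Set (List (∀ n, N n) → ∀ n, N n)} {e : A → ∀ n, N n} (h : IsLimit 𝒢 e)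
    {P : ∀ n, (ℕ → N n) → N n → Prop} (hP : skolem P ∈ 𝒢) {b : ℕ}
    (hb : ∀ n s t m, (∀ v < b, s v = t v) → P n s m → P n t m) (s : ℕ → A) :
    ∃ a, ∀ᶠ n in 𝓤, (∃ m, P n (fun v => e (s v) n) m) → P n (fun v => e (s v) n) (e a n) := by
  obtain ⟨a, ha⟩ := h.closed _ hP ((List.range b).map s)
  refine ⟨a, ha.mono fun n hn => ?_⟩
  rintro ⟨m, hm⟩
  have key : ∀ v < b, (((List.range b).map s).map e).getD v
      (fun _ => Classical.arbitrary _) n = e (s v) n := by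
    intro v hv
    simp [List.getD, hv]
  rw [hn]
  refine hb n _ _ _ key (Classical.epsilon_spec (p := P n _) ⟨m, ?_⟩)
  exact hb n _ _ _ (fun v hv => (key v hv).symm) hm

theorem los {S : Signature} (φ : FOF S) (N : ℕ → Type) [∀ n, Nonempty (N n)]
    (I : ∀ n, Interp S (N n)) :
    ∃ 𝒢 : Set (List (∀ n, N n) → ∀ n, N n), 𝒢.Countable ∧
      ∀ (A : Type) (e : A → ∀ n, N n), IsLimit 𝒢 e → ∀ I' : Interp S A,
      (∀ k r x, x ∈ I' k r ↔ ∀ᶠ n in 𝓤, (fun i => e (x i) n) ∈ I n k r) →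
      ∀ s, FSat A I' s φ ↔ ∀ᶠ n in 𝓤, FSat (N n) (I n) (fun v => e (s v) n) φ := by
  have upd : ∀ (A : Type) (e : A → ∀ n, N n) (s : ℕ → A) (v : ℕ) (a : A) (n : ℕ),
      (fun w => e (Function.update s v a w) n) =
        Function.update (fun w => e (s w) n) v (e a n) := by
    intro A e s v a n
    funext w
    by_cases hw : w = v
    · subst hw; simp
    · simp [Function.update_of_ne hw]
  induction φ with
  | rel r v => exact ⟨∅, by simp, fun A e h I' hI s => by simp only [FSat]; rw [hI]⟩
  | nrel r v =>
    refine ⟨∅, by simp, fun A e h I' hI s => ?_⟩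
    simp only [FSat]
    rw [hI, Ultrafilter.eventually_not]
  | eq x y =>
    refine ⟨∅, by simp, fun A e h I' hI s => ?_⟩
    simp only [FSat]
    exact ⟨fun h => by simp [h], h.inj _ _⟩
  | neq x y =>
    refine ⟨∅, by simp, fun A e h I' hI s => ?_⟩
    simp only [FSat, ne_eq]
    rw [Ultrafilter.eventually_not, not_iff_not]
    exact ⟨fun h => by simp [h], h.inj _ _⟩
  | dep i v => exact i.elim
  | and φ ψ h1 h2 =>
    obtain ⟨G, hG, h1⟩ := h1
    obtain ⟨G', hG', h2⟩ := h2
    refine ⟨G ∪ G', hG.union hG', fun A e h I' hI s => ?_⟩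
    simp only [FSat]
    rw [h1 A e (h.mono Set.subset_union_left) I' hI, h2 A e (h.mono Set.subset_union_right) I' hI,
      eventually_and]
  | or φ ψ h1 h2 | gdisj φ ψ h1 h2 =>
    obtain ⟨G, hG, h1⟩ := h1
    obtain ⟨G', hG', h2⟩ := h2
    refine ⟨G ∪ G', hG.union hG', fun A e h I' hI s => ?_⟩
    simp only [FSat]
    rw [h1 A e (h.mono Set.subset_union_left) I' hI, h2 A e (h.mono Set.subset_union_right) I' hI,
      Ultrafilter.eventually_or]
  | cneg φ h1 =>
    obtain ⟨G, hG, h1⟩ := h1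
    refine ⟨G, hG, fun A e h I' hI s => ?_⟩
    simp only [FSat]
    rw [h1 A e h I' hI, Ultrafilter.eventually_not]
  | ex v φ h1 =>
    obtain ⟨G, hG, h1⟩ := h1
    obtain ⟨b, hb⟩ := fv_bddAbove φ
    let P : ∀ n, (ℕ → N n) → N n → Prop :=
      fun n s m => FSat (N n) (I n) (Function.update s v m) φ
    refine ⟨insert (skolem P) G, hG.insert _, fun A e h I' hI s => ?_⟩
    have hG' := h.mono (Set.subset_insert (skolem P) G)
    simp only [FSat]
    constructor
    · rintro ⟨a, ha⟩
      rw [h1 A e hG' I' hI] at ha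
      refine ha.mono fun n hn => ⟨e a n, ?_⟩
      rwa [upd] at hn
    · intro hex
      obtain ⟨a, ha⟩ := h.exists_skolem (P := P) (Set.mem_insert _ _) (b := b + 1) (by
        intro n s t m hst hs
        refine (FSat_congr (I n) φ _ _ fun w hw => ?_).1 hs
        by_cases hwv : w = v
        · simp [hwv]
        · simp [Function.update_of_ne hwv, hst w (Nat.lt_succ_of_le (hb hw))]) s
      refine ⟨a, ?_⟩
      rw [h1 A e hG' I' hI]
      filter_upwards [hex, ha] with n h1 h2
      rw [upd]
      exact h2 h1
  | al v φ h1 =>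
    obtain ⟨G, hG, h1⟩ := h1
    obtain ⟨b, hb⟩ := fv_bddAbove φ
    let P : ∀ n, (ℕ → N n) → N n → Prop :=
      fun n s m => ¬ FSat (N n) (I n) (Function.update s v m) φ
    refine ⟨insert (skolem P) G, hG.insert _, fun A e h I' hI s => ?_⟩
    have hG' := h.mono (Set.subset_insert (skolem P) G)
    simp only [FSat]
    constructor
    · intro hall
      obtain ⟨a, ha⟩ := h.exists_skolem (P := P) (Set.mem_insert _ _) (b := b + 1) (by
        intro n s t m hst hs
        refine mt (FSat_congr (I n) φ _ _ fun w hw => ?_).1 hs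
        by_cases hwv : w = v
        · simp [hwv]
        · simp [Function.update_of_ne hwv, hst w (Nat.lt_succ_of_le (hb hw))]) s
      have hfa := hall a
      rw [h1 A e hG' I' hI] at hfa
      filter_upwards [hfa, ha] with n h1 h2
      rw [upd] at h1
      by_contra hcon
      push Not at hcon
      exact h2 hcon h1
    · intro hall a
      rw [h1 A e hG' I' hI]
      filter_upwards [hall] with n hn
      rw [upd]
      exact hn _

theorem exists_isLimit {N : ℕ → Type} {𝒢 : Set (List (∀ n, N n) → ∀ n, N n)}
    (h𝒢 : 𝒢.Countable) (c : ℕ → ∀ n, N n)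
    (hc : ∀ i j, (∀ᶠ n in 𝓤, c i n = c j n) → i = j) :
    ∃ e : ℕ → ∀ n, N n, IsLimit 𝒢 e := by
  let step : Set (∀ n, N n) → Set (∀ n, N n) := fun B =>
    B ∪ Set.image2 (fun g l => g l) 𝒢 {l | ∀ x ∈ l, x ∈ B}
  let B : ℕ → Set (∀ n, N n) := fun m => step^[m] (Set.range c)
  have hBs : ∀ m, B (m + 1) = step (B m) := fun m => Function.iterate_succ_apply' _ _ _
  have hBc : ∀ m, (B m).Countable := by
    intro m
    induction m with
    | zero => exact Set.countable_range c
    | succ m ih =>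
      rw [hBs]
      refine ih.union (h𝒢.image2 ?_ _)
      have := ih.to_subtype
      rw [← Set.range_list_map_coe]
      exact Set.countable_range _
  have hmono : Monotone B := monotone_nat_of_le_succ fun m => by
    rw [hBs]; exact Set.subset_union_left
  let C : Set (∀ n, N n) := ⋃ m, B m
  have hC : C.Countable := Set.countable_iUnion hBc
  have hclosed : ∀ g ∈ 𝒢, ∀ l : List (∀ n, N n), (∀ x ∈ l, x ∈ C) → g l ∈ C := by
    intro g hg l hl
    have : ∃ m, ∀ x ∈ l, x ∈ B m := by
      induction l with
      | nil => exact ⟨0, by simp⟩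
      | cons a l ih =>
        obtain ⟨m, hm⟩ := ih fun x hx => hl x (List.mem_cons_of_mem _ hx)
        obtain ⟨m', hm'⟩ := Set.mem_iUnion.1 (hl a List.mem_cons_self)
        refine ⟨max m m', fun x hx => ?_⟩
        rcases List.mem_cons.1 hx with rfl | hx
        · exact hmono (le_max_right _ _) hm'
        · exact hmono (le_max_left _ _) (hm x hx)
    obtain ⟨m, hm⟩ := this
    refine Set.mem_iUnion.2 ⟨m + 1, ?_⟩
    rw [hBs]
    exact Or.inr ⟨g, hg, l, hm, rfl⟩
  let st : Setoid C := ⟨fun x y => ∀ᶠ n in 𝓤, x.1 n = y.1 n,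
    ⟨fun x => by simp, fun h => h.mono fun n hn => hn.symm,
      fun h1 h2 => by filter_upwards [h1, h2] with n a b using a.trans b⟩⟩
  have := hC.to_subtype
  have hcC : ∀ i, c i ∈ C := fun i => Set.mem_iUnion.2 ⟨0, i, rfl⟩
  have : Infinite (Quotient st) :=
    Infinite.of_injective (fun i : ℕ => (⟦⟨c i, hcC i⟩⟧ : Quotient st))
      fun i j hij => hc i j (Quotient.exact hij)
  obtain ⟨E⟩ := nonempty_equiv_of_countable (α := ℕ) (β := Quotient st)
  have hout : ∀ q : Quotient st, ⟦q.out⟧ = q := Quotient.out_eq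
  refine ⟨fun i => ((E i).out : C).1, ⟨fun a b hab => ?_, fun g hg l => ?_⟩⟩
  · apply E.injective
    rw [← hout (E a), ← hout (E b)]
    exact Quotient.sound hab
  · have hx := hclosed g hg (l.map fun i => ((E i).out : C).1) (by
      intro x hx
      obtain ⟨i, -, rfl⟩ := List.mem_map.1 hx
      exact ((E i).out : C).2)
    refine ⟨E.symm ⟦⟨_, hx⟩⟧, ?_⟩
    have h2 := hout (E (E.symm ⟦⟨_, hx⟩⟧))
    rw [Equiv.apply_symm_apply] at h2
    have h3 := Quotient.exact h2
    simp only [Equiv.apply_symm_apply]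
    exact h3

/-- The relation induced by the relations `K n` on a limit. -/
def limRel {N : ℕ → Type} {A : Type} {k : ℕ} (e : A → ∀ n, N n) (K : ∀ n, Set (Fin k → N n)) :
    Set (Fin k → A) := {x | ∀ᶠ n in 𝓤, (fun i => e (x i) n) ∈ K n}

theorem los_sentence {k : ℕ} {ψ : FOF (SigR k)} (hψ : IsSentence ψ) (N : ℕ → Type)
    [∀ n, Nonempty (N n)] (K : ∀ n, Set (Fin k → N n)) :
    ∃ 𝒢 : Set (List (∀ n, N n) → ∀ n, N n), 𝒢.Countable ∧
      ∀ (e : ℕ → ∀ n, N n), IsLimit 𝒢 e →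
      (FOTrue ℕ (interpR (limRel e K)) ψ ↔ ∀ᶠ n in 𝓤, FOTrue (N n) (interpR (K n)) ψ) := by
  obtain ⟨𝒢, h𝒢, h⟩ := los ψ N fun n => interpR (K n)
  refine ⟨𝒢, h𝒢, fun e he => ?_⟩
  rw [FOTrue_iff_FSat _ hψ fun _ => 0, h ℕ e he]
  · exact eventually_congr (Eventually.of_forall fun n => (FOTrue_iff_FSat _ hψ _).symm)
  · intro j r x
    rfl

/-! ### Two sentences of team semantics -/

/-- `Y` is obtained from `X` by (lax) reassignment of the variables in `l`. -/
def Reassigns {M : Type} (l : List ℕ) (X Y : Set (ℕ → M)) : Prop :=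
  (∀ s ∈ X, ∃ s' ∈ Y, ∀ w ∉ l, s' w = s w) ∧ ∀ s' ∈ Y, ∃ s ∈ X, ∀ w ∉ l, s' w = s w

theorem TSat_exs {S : Signature} {ι : Type} {ar : ι → ℕ} {M : Type} (I : Interp S M)
    (A : ∀ i, Set (Fin (ar i) → M) → Prop) (φ : TS S ι ar) (l : List ℕ) (X : Set (ℕ → M)) :
    TSat M I A (exs l φ) X ↔ ∃ Y, Reassigns l X Y ∧ TSat M I A φ Y := by
  induction l generalizing X with
  | nil =>
    constructor
    · exact fun h => ⟨X, ⟨fun s hs => ⟨s, hs, by simp⟩, fun s hs => ⟨s, hs, by simp⟩⟩, h⟩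
    · rintro ⟨Y, ⟨h1, h2⟩, h⟩
      have : X = Y := by
        ext s
        constructor
        · intro hs
          obtain ⟨s', hs', he⟩ := h1 s hs
          rwa [← show s' = s from funext fun w => he w (by simp)]
        · intro hs
          obtain ⟨s', hs', he⟩ := h2 s hs
          rwa [show s = s' from funext fun w => he w (by simp)]
      rwa [this]
  | cons v l ih =>
    change (∃ H : (ℕ → M) → Set M, (∀ s ∈ X, (H s).Nonempty) ∧
      TSat M I A (exs l φ) {s' | ∃ s ∈ X, ∃ m ∈ H s, s' = Function.update s v m}) ↔ _
    simp only [ih]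
    constructor
    · rintro ⟨H, hH, Y, ⟨h1, h2⟩, h⟩
      refine ⟨Y, ⟨fun s hs => ?_, fun s' hs' => ?_⟩, h⟩
      · obtain ⟨m, hm⟩ := hH s hs
        obtain ⟨s', hs', he⟩ := h1 _ ⟨s, hs, m, hm, rfl⟩
        refine ⟨s', hs', fun w hw => ?_⟩
        simp only [List.mem_cons, not_or] at hw
        rw [he w hw.2, Function.update_of_ne hw.1]
      · obtain ⟨_, ⟨s, hs, m, hm, rfl⟩, he⟩ := h2 s' hs'
        refine ⟨s, hs, fun w hw => ?_⟩
        simp only [List.mem_cons, not_or] at hw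
        rw [he w hw.2, Function.update_of_ne hw.1]
    · rintro ⟨Y, ⟨h1, h2⟩, h⟩
      have key : ∀ s s' : ℕ → M, (∀ w ∉ v :: l, s' w = s w) →
          ∀ w ∉ l, s' w = Function.update s v (s' v) w := by
        intro s s' hss w hw
        by_cases hwv : w = v
        · simp [hwv]
        · rw [Function.update_of_ne hwv]
          exact hss w (by simp [hwv, hw])
      refine ⟨fun s => {m | ∃ s' ∈ Y, ∀ w ∉ l, s' w = Function.update s v m w}, ?_, Y, ⟨?_, ?_⟩, h⟩
      · intro s hs
        obtain ⟨s', hs', he⟩ := h1 s hs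
        exact ⟨s' v, s', hs', key s s' he⟩
      · rintro _ ⟨s, hs, m, ⟨s', hs', he⟩, rfl⟩
        exact ⟨s', hs', he⟩
      · intro s' hs'
        obtain ⟨s, hs, he⟩ := h2 s' hs'
        exact ⟨_, ⟨s, hs, s' v, ⟨s', hs', key s s' he⟩, rfl⟩, key s s' he⟩

/-- Iterated universal quantification over a list of variables. -/
def als {S : Signature} {ι : Type} {ar : ι → ℕ} (l : List ℕ) (φ : TS S ι ar) :
    TS S ι ar := l.foldr TS.al φ

theorem TSat_als {S : Signature} {ι : Type} {ar : ι → ℕ} {M : Type} (I : Interp S M)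
    (A : ∀ i, Set (Fin (ar i) → M) → Prop) (φ : TS S ι ar) (l : List ℕ) (X : Set (ℕ → M)) :
    TSat M I A (als l φ) X ↔ TSat M I A φ {s' | ∃ s ∈ X, ∀ w ∉ l, s' w = s w} := by
  induction l generalizing X with
  | nil =>
    have : {s' | ∃ s ∈ X, ∀ w ∉ ([] : List ℕ), s' w = s w} = X := by
      ext s
      constructor
      · rintro ⟨s', hs', he⟩
        rwa [show s = s' from funext fun w => he w (by simp)]
      · exact fun hs => ⟨s, hs, by simp⟩
    rw [this]; rfl
  | cons v l ih =>
    change TSat M I A (als l φ) {s' | ∃ s ∈ X, ∃ m : M, s' = Function.update s v m} ↔ _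
    rw [ih]
    refine iff_of_eq (congrArg _ ?_)
    ext s'
    constructor
    · rintro ⟨_, ⟨s, hs, m, rfl⟩, he⟩
      refine ⟨s, hs, fun w hw => ?_⟩
      simp only [List.mem_cons, not_or] at hw
      rw [he w hw.2, Function.update_of_ne hw.1]
    · rintro ⟨s, hs, he⟩
      refine ⟨_, ⟨s, hs, s' v, rfl⟩, fun w hw => ?_⟩
      by_cases hwv : w = v
      · simp [hwv]
      · rw [Function.update_of_ne hwv]
        exact he w (by simp [hwv, hw])

theorem fv_exs {S : Signature} {ι : Type} {ar : ι → ℕ} (φ : TS S ι ar) (l : List ℕ) :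
    fv (exs l φ) = {v ∈ fv φ | v ∉ l} := by
  induction l with
  | nil => simp [exs]
  | cons v l ih =>
    change fv (exs l φ) \ {v} = _
    rw [ih]; ext w; simp; tauto

theorem fv_als {S : Signature} {ι : Type} {ar : ι → ℕ} (φ : TS S ι ar) (l : List ℕ) :
    fv (als l φ) = {v ∈ fv φ | v ∉ l} := by
  induction l with
  | nil => simp [als]
  | cons v l ih =>
    change fv (als l φ) \ {v} = _
    rw [ih]; ext w; simp; tauto

theorem Plain_exs {S : Signature} {ι : Type} {ar : ι → ℕ} {φ : TS S ι ar} (h : Plain φ)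
    (l : List ℕ) : Plain (exs l φ) := by
  induction l with
  | nil => exact h
  | cons v l ih => exact ih

theorem Plain_als {S : Signature} {ι : Type} {ar : ι → ℕ} {φ : TS S ι ar} (h : Plain φ)
    (l : List ℕ) : Plain (als l φ) := by
  induction l with
  | nil => exact h
  | cons v l ih => exact ih

theorem mem_shifted_range {k w : ℕ} : w ∈ (List.range k).map Nat.succ ↔ 1 ≤ w ∧ w ≤ k := by
  simp only [List.mem_map, List.mem_range]
  constructor
  · rintro ⟨a, ha, rfl⟩; omega
  · rintro ⟨h1, h2⟩; exact ⟨w - 1, by omega, by omega⟩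

/-- Reassign the variables `1, …, k`. -/
def overrideSucc {M : Type} {k : ℕ} (x : Fin k → M) (s : ℕ → M) : ℕ → M :=
  fun w => if h : 1 ≤ w ∧ w ≤ k then x ⟨w - 1, by omega⟩ else s w

theorem overrideSucc_zero {M : Type} {k : ℕ} (x : Fin k → M) (s : ℕ → M) :
    overrideSucc x s 0 = s 0 := by simp [overrideSucc]

theorem overrideSucc_succ {M : Type} {k : ℕ} (x : Fin k → M) (s : ℕ → M) :
    (fun i : Fin k => overrideSucc x s (i + 1)) = x := by
  funext i
  have : (i : ℕ) < k := i.2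
  simp [overrideSucc, this]

theorem overrideSucc_of_notMem {M : Type} {k : ℕ} (x : Fin k → M) (s : ℕ → M) {w : ℕ}
    (hw : w ∉ (List.range k).map Nat.succ) : overrideSucc x s w = s w := by
  rw [mem_shifted_range] at hw
  simp [overrideSucc, hw]

theorem cons_zero_succ {M : Type} {k : ℕ} (s : ℕ → M) :
    (fun i : Fin (k + 1) => s i) = Fin.cons (s 0) fun i : Fin k => s (i + 1) := by
  funext i
  refine Fin.cases ?_ (fun j => ?_) i <;> simp

theorem mem_interpR_cons {M : Type} {k : ℕ} (K : Set (Fin (k + 1) → M)) (s : ℕ → M) :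
    (fun i : Fin (k + 1) => s i) ∈ interpR K (k + 1) ⟨rfl⟩ ↔
      (Fin.cons (s 0) fun i : Fin k => s (i + 1) : Fin (k + 1) → M) ∈ K := by
  rw [← cons_zero_succ]; rfl

theorem SFOd.exists_sentence_cover {k : ℕ} {D : DepPred k} (hD : SFOd D) :
    ∃ ψ : FOF (SigR (k + 1)), IsSentence ψ ∧ ∀ (M : Type), Nontrivial M →
      ∀ K : Set (Fin (k + 1) → M), FOTrue M (interpR K) ψ ↔
        ∃ S, D M S ∧ (∀ t, ∃ x ∈ S, (Fin.cons t x : Fin (k + 1) → M) ∈ K) ∧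
          ∀ x ∈ S, ∃ t, (Fin.cons t x : Fin (k + 1) → M) ∈ K := by
  let l := (List.range k).map Nat.succ
  let χ : TS (SigR (k + 1)) Unit (fun _ => k) :=
    .and (.rel (k := k + 1) ⟨rfl⟩ fun i => i) (.dep () fun i => i + 1)
  have hfv : IsSentence (als [0] (exs l χ)) := by
    rw [IsSentence, fv_als, fv_exs, Set.eq_empty_iff_forall_notMem]
    rintro v ⟨⟨hv, hvl⟩, hv0⟩
    rw [mem_shifted_range] at hvl
    simp only [List.mem_singleton] at hv0
    rcases hv with ⟨i, rfl⟩ | ⟨i, rfl⟩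
    · have := i.2
      dsimp only at *
      omega
    · have : (i : ℕ) < k := i.2
      dsimp only at *
      omega
  obtain ⟨ψ, hψ, h⟩ := hD _ _ hfv (Plain_als (Plain_exs (by simp [χ, Plain, NoCneg, NoGdisj]) _) _)
  refine ⟨ψ, hψ, fun M hM K => ?_⟩
  rw [← h M hM, TTrue, TSat_als]
  have hu : {s' : ℕ → M | ∃ s ∈ (Set.univ : Set (ℕ → M)), ∀ w ∉ [0], s' w = s w} = Set.univ :=
    Set.eq_univ_of_forall fun s => ⟨s, trivial, fun _ _ => rfl⟩
  rw [hu, TSat_exs]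
  constructor
  · rintro ⟨Y, ⟨h1, -⟩, hK, hdep⟩
    refine ⟨_, hdep, fun t => ?_, ?_⟩
    · obtain ⟨s, hs, he⟩ := h1 (fun _ => t) trivial
      refine ⟨_, ⟨s, hs, rfl⟩, ?_⟩
      have := hK s hs
      rw [mem_interpR_cons, he 0 (by simp [l])] at this
      exact this
    · rintro _ ⟨s, hs, rfl⟩
      exact ⟨s 0, (mem_interpR_cons K s).1 (hK s hs)⟩
  · rintro ⟨S, hS, h1, h2⟩
    refine ⟨{s | (fun i : Fin k => s (i + 1)) ∈ S ∧
      (Fin.cons (s 0) fun i : Fin k => s (i + 1) : Fin (k + 1) → M) ∈ K},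
      ⟨fun s _ => ?_, fun s _ => ⟨s, trivial, fun _ _ => rfl⟩⟩,
      fun s hs => (mem_interpR_cons K s).2 hs.2, ?_⟩
    · obtain ⟨x, hx, hxK⟩ := h1 (s 0)
      refine ⟨overrideSucc x s, ?_, fun w hw => overrideSucc_of_notMem x s hw⟩
      simp only [Set.mem_ofPred_eq, overrideSucc_succ, overrideSucc_zero]
      exact ⟨hx, hxK⟩
    · change D M (teamProj _ _)
      convert hS
      ext x
      constructor
      · rintro ⟨s, hs, rfl⟩; exact hs.1
      · intro hx
        obtain ⟨t, ht⟩ := h2 x hx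
        refine ⟨overrideSucc x fun _ => t, ?_, (overrideSucc_succ x _).symm⟩
        simp only [Set.mem_ofPred_eq, overrideSucc_succ, overrideSucc_zero]
        exact ⟨hx, ht⟩

theorem SFOd.exists_sentence_iUnion {k : ℕ} {D : DepPred k} (hD : SFOd D) :
    ∃ ψ : FOF (SigR (k + 1)), IsSentence ψ ∧ ∀ (M : Type), Nontrivial M →
      ∀ K : Set (Fin (k + 1) → M), FOTrue M (interpR K) ψ ↔
        ∃ J : Set M, J.Nonempty ∧ D M {x | ∃ t ∈ J, (Fin.cons t x : Fin (k + 1) → M) ∈ K} := by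
  let l := (List.range k).map Nat.succ
  let χ : TS (SigR (k + 1)) Unit (fun _ => k) :=
    .or (.and (.rel (k := k + 1) ⟨rfl⟩ fun i => i) (.dep () fun i => i + 1))
      (.nrel (k := k + 1) ⟨rfl⟩ fun i => i)
  have hfv : IsSentence (exs [0] (als l χ)) := by
    rw [IsSentence, fv_exs, fv_als, Set.eq_empty_iff_forall_notMem]
    rintro v ⟨⟨hv, hvl⟩, hv0⟩
    rw [mem_shifted_range] at hvl
    simp only [List.mem_singleton] at hv0
    rcases hv with (⟨i, rfl⟩ | ⟨i, rfl⟩) | ⟨i, rfl⟩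
    · have := i.2
      dsimp only at *
      omega
    · have : (i : ℕ) < k := i.2
      dsimp only at *
      omega
    · have := i.2
      dsimp only at *
      omega
  obtain ⟨ψ, hψ, h⟩ := hD _ _ hfv (Plain_exs (Plain_als (by simp [χ, Plain, NoCneg, NoGdisj]) _) _)
  refine ⟨ψ, hψ, fun M hM K => ?_⟩
  rw [← h M hM, TTrue, TSat_exs]
  simp only [TSat_als]
  constructor
  · rintro ⟨X, ⟨h1, -⟩, Y, Z, hYZ, ⟨hY, hdep⟩, hZ⟩
    refine ⟨{t | ∃ s ∈ X, s 0 = t}, ?_, ?_⟩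
    · obtain ⟨m⟩ : Nonempty M := inferInstance
      obtain ⟨s, hs, -⟩ := h1 (fun _ => m) trivial
      exact ⟨s 0, s, hs, rfl⟩
    · change D M (teamProj _ _) at hdep
      convert hdep
      ext x
      constructor
      · rintro ⟨_, ⟨s, hs, rfl⟩, hK⟩
        have hmem : overrideSucc x s ∈ Y ∪ Z := by
          rw [hYZ]
          exact ⟨s, hs, fun w hw => overrideSucc_of_notMem x s hw⟩
        rcases hmem with hm | hm
        · exact ⟨_, hm, (overrideSucc_succ x s).symm⟩
        · refine absurd ?_ (hZ _ hm)
          rw [mem_interpR_cons, overrideSucc_zero, overrideSucc_succ]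
          exact hK
      · rintro ⟨s', hs', rfl⟩
        obtain ⟨s, hs, he⟩ : s' ∈ {s' | ∃ s ∈ X, ∀ w ∉ l, s' w = s w} := hYZ ▸ Or.inl hs'
        refine ⟨s' 0, ⟨s, hs, (he 0 (by simp [l])).symm⟩, ?_⟩
        exact (mem_interpR_cons K s').1 (hY s' hs')
  · rintro ⟨J, ⟨t₀, ht₀⟩, hJ⟩
    let c : (ℕ → M) → Prop := fun s =>
      (Fin.cons (s 0) fun i : Fin k => s (i + 1) : Fin (k + 1) → M) ∈ K
    refine ⟨{s | s 0 ∈ J}, ⟨fun s _ => ⟨Function.update s 0 t₀, by simpa using ht₀, fun w hw => ?_⟩,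
      fun s _ => ⟨s, trivial, fun _ _ => rfl⟩⟩, {s | s 0 ∈ J ∧ c s}, {s | s 0 ∈ J ∧ ¬ c s},
      ?_, ⟨?_, ?_⟩, ?_⟩
    · rw [Function.update_of_ne (by simpa using hw)]
    · ext s
      constructor
      · intro hs
        refine ⟨s, ?_, fun _ _ => rfl⟩
        rcases hs with hs | hs
        exacts [hs.1, hs.1]
      · rintro ⟨s', hs', he⟩
        have h0 : s 0 ∈ J := by rw [he 0 (by simp [l])]; exact hs'
        by_cases hc : c s
        · exact Or.inl ⟨h0, hc⟩
        · exact Or.inr ⟨h0, hc⟩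
    · exact fun s hs => (mem_interpR_cons K s).2 hs.2
    · change D M (teamProj _ _)
      convert hJ
      ext x
      constructor
      · rintro ⟨s, hs, rfl⟩; exact ⟨s 0, hs⟩
      · rintro ⟨t, ht, hK⟩
        refine ⟨overrideSucc x fun _ => t, ?_, (overrideSucc_succ x _).symm⟩
        simp only [Set.mem_ofPred_eq, c, overrideSucc_succ, overrideSucc_zero]
        exact ⟨ht, hK⟩
    · exact fun s hs => mt (mem_interpR_cons K s).1 hs.2

theorem IsLimit.eventually_eq_iff {N : ℕ → Type} {A : Type}
    {𝒢 : Set (List (∀ n, N n) → ∀ n, N n)} {e : A → ∀ n, N n} (h : IsLimit 𝒢 e) (s : Finset A) :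
    ∀ᶠ n in 𝓤, ∀ a ∈ s, ∀ b ∈ s, e a n = e b n ↔ a = b := by
  rw [eventually_all_finset]
  intro a _
  rw [eventually_all_finset]
  intro b _
  by_cases hab : a = b
  · simp [hab]
  · have : ∀ᶠ n in 𝓤, ¬ e a n = e b n := Ultrafilter.eventually_not.2 (mt (h.inj a b) hab)
    exact this.mono fun n hn => iff_of_false hn hab

/-! ### Finite partial permutations -/

/-- The finite relation `p` extends to a permutation. -/
def Extendable (p : Finset (ℕ × ℕ)) : Prop := ∃ ρ : Equiv.Perm ℕ, ∀ u ∈ p, ρ u.1 = u.2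

theorem extendable_of_eq_iff {p : Finset (ℕ × ℕ)} (h : ∀ u ∈ p, ∀ v ∈ p, u.1 = v.1 ↔ u.2 = v.2) :
    Extendable p := by
  induction p using Finset.induction_on with
  | empty => exact ⟨1, by simp⟩
  | insert u p hu ih =>
    obtain ⟨ρ, hρ⟩ := ih fun v hv w hw =>
      h v (Finset.mem_insert_of_mem hv) w (Finset.mem_insert_of_mem hw)
    refine ⟨Equiv.swap (ρ u.1) u.2 * ρ, fun v hv => ?_⟩
    rcases Finset.mem_insert.1 hv with rfl | hv'
    · simp
    · by_cases huv : v.1 = u.1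
      · have := (h v hv u (Finset.mem_insert_self _ _)).1 huv
        simp [huv, this]
      · have h2 := mt (h v hv u (Finset.mem_insert_self _ _)).2 huv
        rw [Equiv.Perm.mul_apply, hρ v hv', Equiv.swap_apply_of_ne_of_ne]
        · rw [← hρ v hv']
          exact fun hc => huv (ρ.injective hc)
        · exact h2

theorem exists_perm_of_requirements {p₀ : Finset (ℕ × ℕ)} (h₀ : Extendable p₀)
    (Req : ℕ → Finset (ℕ × ℕ) → Prop)
    (hReq : ∀ t p, Extendable p → p₀ ⊆ p → ∃ q, Extendable q ∧ p ⊆ q ∧ Req t q) :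
    ∃ σ : Equiv.Perm ℕ, (∀ u ∈ p₀, σ u.1 = u.2) ∧ ∀ t, ∃ q, Req t q ∧ ∀ u ∈ q, σ u.1 = u.2 := by
  have step : ∀ (t : ℕ) (p : {p // Extendable p ∧ p₀ ⊆ p}),
      ∃ q : {p // Extendable p ∧ p₀ ⊆ p}, p.1 ⊆ q.1 ∧ (∃ r, r ⊆ q.1 ∧ Req t r) ∧
        (∃ b, (t, b) ∈ q.1) ∧ ∃ a, (a, t) ∈ q.1 := by
    rintro t ⟨p, hp, hp₀⟩
    obtain ⟨q, ⟨ρ, hρ⟩, hpq, hq⟩ := hReq t p hp hp₀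
    have hsub : q ⊆ q ∪ {(t, ρ t), (ρ.symm t, t)} := Finset.subset_union_left
    refine ⟨⟨q ∪ {(t, ρ t), (ρ.symm t, t)}, ⟨ρ, fun u hu => ?_⟩, (hp₀.trans hpq).trans hsub⟩,
      hpq.trans hsub, ⟨q, hsub, hq⟩, ⟨ρ t, by simp⟩, ρ.symm t, by simp⟩
    simp only [Finset.mem_union, Finset.mem_insert, Finset.mem_singleton] at hu
    rcases hu with hu | rfl | rfl
    · exact hρ u hu
    · rfl
    · simp
  choose f hf using step
  let P : ℕ → {p // Extendable p ∧ p₀ ⊆ p} := fun n =>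
    Nat.rec ⟨p₀, h₀, subset_rfl⟩ (fun t p => f t p) n
  have hP : ∀ n, P (n + 1) = f n (P n) := fun n => rfl
  have hmono : Monotone fun n => (P n).1 :=
    monotone_nat_of_le_succ fun n => by rw [hP]; exact (hf n (P n)).1
  have hcoh : ∀ m n, ∀ u ∈ (P m).1, ∀ v ∈ (P n).1, u.1 = v.1 ↔ u.2 = v.2 := by
    intro m n u hu v hv
    obtain ⟨ρ, hρ⟩ := (P (max m n)).2.1
    rw [← hρ u (hmono (le_max_left m n) hu), ← hρ v (hmono (le_max_right m n) hv),
      ρ.injective.eq_iff]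
  have htot : ∀ t, ∃ b, (t, b) ∈ (P (t + 1)).1 := fun t => by rw [hP]; exact (hf t (P t)).2.2.1
  have hsurj : ∀ t, ∃ a, (a, t) ∈ (P (t + 1)).1 := fun t => by rw [hP]; exact (hf t (P t)).2.2.2
  choose g hg using htot
  have hgeq : ∀ n, ∀ u ∈ (P n).1, g u.1 = u.2 := fun n u hu =>
    (hcoh (u.1 + 1) n (u.1, g u.1) (hg u.1) u hu).1 rfl
  refine ⟨Equiv.ofBijective g ⟨fun a b hab => (hcoh (a + 1) (b + 1) (a, g a) (hg a) (b, g b) (hg b)).2 hab, fun t => ?_⟩,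
    fun u hu => hgeq 0 u hu, fun t => ?_⟩
  · obtain ⟨a, ha⟩ := hsurj t
    exact ⟨a, hgeq (t + 1) (a, t) ha⟩
  · obtain ⟨r, hr, hreq⟩ := (hf t (P t)).2.1
    exact ⟨r, hreq, fun u hu => hgeq (t + 1) u (by rw [hP]; exact hr hu)⟩

/-! ### Relations on `ℕ` up to permutations fixing a finite set -/

/-- `x` and `y` have the same equality type over `F`. -/
def EqvOver {k : ℕ} (F : Finset ℕ) (x y : Fin k → ℕ) : Prop :=
  (∀ i j, x i = x j ↔ y i = y j) ∧ ∀ i, x i ∈ F ∨ y i ∈ F → x i = y i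

namespace EqvOver
variable {k : ℕ} {F G : Finset ℕ} {x y z : Fin k → ℕ}

theorem refl (F : Finset ℕ) (x : Fin k → ℕ) : EqvOver F x x := ⟨fun _ _ => Iff.rfl, fun _ _ => rfl⟩

theorem symm (h : EqvOver F x y) : EqvOver F y x :=
  ⟨fun i j => (h.1 i j).symm, fun i hi => (h.2 i hi.symm).symm⟩

theorem trans (h : EqvOver F x y) (h' : EqvOver F y z) : EqvOver F x z := by
  refine ⟨fun i j => (h.1 i j).trans (h'.1 i j), fun i hi => ?_⟩
  rcases hi with hi | hi
  · have h1 := h.2 i (Or.inl hi)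
    exact h1.trans (h'.2 i (Or.inl (h1 ▸ hi)))
  · have h1 := h'.2 i (Or.inr hi)
    exact (h.2 i (Or.inr (h1 ▸ hi))).trans h1

theorem mono (hFG : F ⊆ G) (h : EqvOver G x y) : EqvOver F x y :=
  ⟨h.1, fun i hi => h.2 i (hi.imp (@hFG _) (@hFG _))⟩

theorem mem_iff (h : EqvOver F x y) (i : Fin k) : x i ∈ F ↔ y i ∈ F :=
  ⟨fun hi => h.2 i (Or.inl hi) ▸ hi, fun hi => (h.2 i (Or.inr hi)).symm ▸ hi⟩

theorem perm {ρ : Equiv.Perm ℕ} (hρ : ∀ a ∈ F, ρ a = a) (x : Fin k → ℕ) : EqvOver F (ρ ∘ x) x := by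
  refine ⟨fun i j => by simp, fun i hi => ?_⟩
  rcases hi with hi | hi
  · exact ρ.injective (hρ _ hi)
  · exact hρ _ hi

end EqvOver

/-- The closure of `R` under sameness of type over `F`. -/
def typeClosure {k : ℕ} (F : Finset ℕ) (R : Set (Fin k → ℕ)) : Set (Fin k → ℕ) :=
  {x | ∃ r ∈ R, EqvOver F x r}

/-- `K` meets every permuted copy of `R` over `F`, even over `n` further parameters. -/
def Meets {k : ℕ} (n : ℕ) (R : Set (Fin k → ℕ)) (F : Finset ℕ) (K : Set (Fin k → ℕ)) : Prop :=
  ∀ ρ : Equiv.Perm ℕ, (∀ a ∈ F, ρ a = a) → ∀ d : Finset ℕ, d.card ≤ n →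
    ∃ x ∈ K, ρ ∘ x ∈ typeClosure (F ∪ d) R

theorem exists_extension {k : ℕ} {R : Set (Fin k → ℕ)} {F : Finset ℕ}
    {K : ℕ → ℕ → Set (Fin k → ℕ)} (hK : ∀ n t, Meets n R F (K n t)) :
    ∃ 𝒢 : Set (List (ℕ → ℕ) → ℕ → ℕ), 𝒢.Countable ∧
      ∀ e : ℕ → ℕ → ℕ, IsLimit (N := fun _ => ℕ) 𝒢 e →
      ∀ p : Finset (ℕ × ℕ), Extendable p →
        (∀ a ∈ F, ∃ c, (c, a) ∈ p ∧ ∀ᶠ n in 𝓤, e c n = a) → ∀ t : ℕ,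
      ∃ (x r : Fin k → ℕ), r ∈ R ∧ (∀ᶠ n in 𝓤, (fun i => e (x i) n) ∈ K n (e t n)) ∧
        Extendable (p ∪ Finset.univ.image fun i => (x i, r i)) := by
  let T : ℕ → ℕ → List (ℕ × ℕ) → (Fin k → ℕ) → Prop := fun n tv w z =>
    z ∈ K n tv ∧ ∃ r ∈ R, (∀ i j, z i = z j ↔ r i = r j) ∧ ∀ i, ∀ u ∈ w, z i = u.1 ↔ r i = u.2
  let g : Fin k × List ℕ → List (ℕ → ℕ) → ℕ → ℕ := fun a l n =>
    Classical.epsilon (T n (l.headD 0 n) ((l.tail.map fun f => f n).zip a.2)) a.1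
  refine ⟨Set.range g, Set.countable_range g, fun e he p hp hF t => ?_⟩
  let P := p.toList
  have hx : ∀ i : Fin k, ∃ a, ∀ᶠ n in 𝓤, e a n =
      Classical.epsilon (T n (e t n) (P.map fun u => (e u.1 n, u.2))) i := by
    intro i
    obtain ⟨a, ha⟩ := he.closed _ ⟨(i, P.map Prod.snd), rfl⟩ (t :: P.map Prod.fst)
    refine ⟨a, ha.mono fun n hn => hn.trans ?_⟩
    simp only [g, List.map_cons, List.headD_cons, List.tail_cons, List.map_map, List.zip_map']
    rfl
  choose x hx using hx
  have hx : ∀ᶠ n in 𝓤, (fun i => e (x i) n) =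
      Classical.epsilon (T n (e t n) (P.map fun u => (e u.1 n, u.2))) :=
    (eventually_all.2 hx).mono fun n hn => funext hn
  have hex : ∀ᶠ n in 𝓤, ∃ z, T n (e t n) (P.map fun u => (e u.1 n, u.2)) z := by
    choose! c hc hce using hF
    have h1 : ∀ᶠ n in 𝓤, ∀ a ∈ F, e (c a) n = a := (eventually_all_finset F).2 hce
    have h2 := he.eventually_eq_iff (p.image Prod.fst)
    have h3 : ∀ᶠ n in 𝓤, (p.image Prod.snd).card ≤ n :=
      Nat.hyperfilter_le_atTop (eventually_ge_atTop _)
    filter_upwards [h1, h2, h3] with n h1 h2 h3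
    obtain ⟨σ, hσ⟩ := hp
    obtain ⟨ρ, hρ⟩ : Extendable (p.image fun u => (e u.1 n, u.2)) := by
      apply extendable_of_eq_iff
      intro u' hu' v' hv'
      obtain ⟨u, hu, rfl⟩ := Finset.mem_image.1 hu'
      obtain ⟨v, hv, rfl⟩ := Finset.mem_image.1 hv'
      dsimp only
      rw [h2 _ (Finset.mem_image_of_mem _ hu) _ (Finset.mem_image_of_mem _ hv), ← hσ u hu,
        ← hσ v hv, σ.injective.eq_iff]
    have hρ' : ∀ u ∈ p, ρ (e u.1 n) = u.2 := fun u hu => hρ _ (Finset.mem_image_of_mem _ hu)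
    obtain ⟨z, hz, r, hr, hzr⟩ := hK n (e t n) ρ
      (fun a ha => by have := hρ' _ (hc a ha); rwa [h1 a ha] at this) _ h3
    refine ⟨z, hz, r, hr, fun i j => ?_, fun i u' hm => ?_⟩
    · rw [← hzr.1 i j]; simp
    · obtain ⟨u, hu, rfl⟩ := List.mem_map.1 hm
      have hu' : u ∈ p := Finset.mem_toList.1 hu
      have hmem : u.2 ∈ F ∪ p.image Prod.snd :=
        Finset.mem_union_right _ (Finset.mem_image_of_mem _ hu')
      rw [← ρ.injective.eq_iff]
      dsimp only
      rw [hρ' u hu']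
      constructor
      · intro h
        rw [← hzr.2 i (Or.inl (by rw [Function.comp_apply, h]; exact hmem))]
        exact h
      · intro h
        rw [← h, ← hzr.2 i (Or.inr (by rw [h]; exact hmem))]
        rfl
  have hT : ∀ᶠ n in 𝓤, T n (e t n) (P.map fun u => (e u.1 n, u.2)) fun i => e (x i) n := by
    filter_upwards [hx, hex] with n h1 h2
    rw [h1]
    exact Classical.epsilon_spec h2
  have hinj := he.eventually_eq_iff (p.image Prod.fst ∪ Finset.univ.image x)
  obtain ⟨n, ⟨-, r, hr, hr1, hr2⟩, hn⟩ := (hT.and hinj).exists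
  refine ⟨x, r, hr, hT.mono fun n hn => hn.1, extendable_of_eq_iff ?_⟩
  have hxm : ∀ i, x i ∈ p.image Prod.fst ∪ Finset.univ.image x := fun i => by simp
  have hpm : ∀ u ∈ p, u.1 ∈ p.image Prod.fst ∪ Finset.univ.image x := fun u hu =>
    Finset.mem_union_left _ (Finset.mem_image_of_mem _ hu)
  have hxx : ∀ i j, x i = x j ↔ r i = r j := fun i j => by
    rw [← hn _ (hxm i) _ (hxm j), hr1]
  have hxp : ∀ i, ∀ u ∈ p, x i = u.1 ↔ r i = u.2 := fun i u hu => by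
    rw [← hn _ (hxm i) _ (hpm u hu)]
    exact hr2 i _ (List.mem_map.2 ⟨u, Finset.mem_toList.2 hu, rfl⟩)
  obtain ⟨σ, hσ⟩ := hp
  intro u hu v hv
  rcases Finset.mem_union.1 hu with hu | hu <;> rcases Finset.mem_union.1 hv with hv | hv
  · rw [← hσ u hu, ← hσ v hv, σ.injective.eq_iff]
  · obtain ⟨j, -, rfl⟩ := Finset.mem_image.1 hv
    rw [eq_comm, hxp j u hu, eq_comm]
  · obtain ⟨i, -, rfl⟩ := Finset.mem_image.1 hu
    exact hxp i v hv
  · obtain ⟨i, -, rfl⟩ := Finset.mem_image.1 hu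
    obtain ⟨j, -, rfl⟩ := Finset.mem_image.1 hv
    exact hxx i j

theorem exists_selection {k : ℕ} {D : DepPred k} (hiso : IsoClosed D) (hD : SFOd D)
    {R : Set (Fin k → ℕ)} (hR : D ℕ R) (F : Finset ℕ) {K : ℕ → ℕ → Set (Fin k → ℕ)}
    (hK : ∀ n t, Meets n R F (K n t)) (hK₀ : ∀ n, typeClosure F R ⊆ K n 0) :
    ∃ n S, D ℕ S ∧ (∀ t, (S ∩ K n t).Nonempty) ∧ ∀ x ∈ S, ∃ t, x ∈ K n t := by
  obtain ⟨ψ, hψ, hψD⟩ := hD.exists_sentence_cover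
  by_contra hcon
  let L : ℕ → Set (Fin (k + 1) → ℕ) := fun n => {y | Fin.tail y ∈ K n (y 0)}
  have hL : ∀ n t x, (Fin.cons t x : Fin (k + 1) → ℕ) ∈ L n ↔ x ∈ K n t := by
    intro n t x
    simp [L]
  have hfalse : ∀ n, ¬ FOTrue ℕ (interpR (L n)) ψ := by
    intro n hn
    obtain ⟨S, hS, h1, h2⟩ := (hψD ℕ inferInstance (L n)).1 hn
    refine hcon ⟨n, S, hS, fun t => ?_, fun x hx => ?_⟩
    · obtain ⟨x, hx, hxt⟩ := h1 t
      exact ⟨x, hx, (hL _ _ _).1 hxt⟩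
    · obtain ⟨t, ht⟩ := h2 x hx
      exact ⟨t, (hL _ _ _).1 ht⟩
  obtain ⟨𝒢, h𝒢, hlos⟩ := los_sentence hψ (fun _ => ℕ) L
  obtain ⟨ℋ, hℋ, hext⟩ := exists_extension hK
  let const : ℕ → List (ℕ → ℕ) → ℕ → ℕ := fun a _ _ => a
  obtain ⟨e, he⟩ := exists_isLimit (N := fun _ => ℕ)
    ((h𝒢.union hℋ).union (Set.countable_range const)) (fun i _ => i) (by simp)
  have he1 := he.mono (Set.subset_union_left.trans Set.subset_union_left)
  have he2 := he.mono (Set.subset_union_right.trans Set.subset_union_left)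
  have hc : ∀ a, ∃ c, ∀ᶠ n in 𝓤, e c n = a := fun a => he.closed (const a) (Or.inr ⟨a, rfl⟩) []
  choose c hc using hc
  have hcinj : ∀ a b, c a = c b → a = b := by
    intro a b hab
    obtain ⟨n, h1, h2⟩ := ((hc a).and (hc b)).exists
    rw [← h1, ← h2, hab]
  have hnot : ¬ FOTrue ℕ (interpR (limRel (N := fun _ => ℕ) e L)) ψ := by
    rw [hlos e he1]
    intro h
    obtain ⟨n, hn⟩ := h.exists
    exact hfalse n hn
  apply hnot
  rw [hψD ℕ inferInstance]
  have hlim : ∀ t x, (Fin.cons t x : Fin (k + 1) → ℕ) ∈ limRel (N := fun _ => ℕ) e L ↔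
      ∀ᶠ n in 𝓤, (fun i => e (x i) n) ∈ K n (e t n) := by
    intro t x
    refine eventually_congr (Eventually.of_forall fun n => ?_)
    rw [← hL]
    refine iff_of_eq (congrArg (· ∈ L n) (funext fun i => ?_))
    refine Fin.cases ?_ (fun j => ?_) i <;> simp
  obtain ⟨σ, hσ, hσR⟩ := exists_perm_of_requirements (p₀ := F.image fun a => (c a, a))
    (extendable_of_eq_iff (by
      intro u hu v hv
      obtain ⟨a, -, rfl⟩ := Finset.mem_image.1 hu
      obtain ⟨b, -, rfl⟩ := Finset.mem_image.1 hv
      exact ⟨hcinj a b, fun h => congrArg c h⟩))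
    (fun t q => ∃ x r : Fin k → ℕ, r ∈ R ∧ (Fin.cons t x : Fin (k + 1) → ℕ) ∈
      limRel (N := fun _ => ℕ) e L ∧ ∀ i, (x i, r i) ∈ q)
    (fun t p hp hp₀ => by
      obtain ⟨x, r, hr, hxr, hq⟩ := hext e he2 p hp
        (fun a ha => ⟨c a, hp₀ (Finset.mem_image_of_mem _ ha), hc a⟩) t
      exact ⟨_, hq, Finset.subset_union_left, x, r, hr, (hlim t x).2 hxr, fun i =>
        Finset.mem_union_right _ (Finset.mem_image_of_mem _ (Finset.mem_univ i))⟩)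
  have hσc : ∀ a ∈ F, σ (c a) = a := fun a ha =>
    hσ _ (Finset.mem_image_of_mem (fun a => (c a, a)) ha)
  refine ⟨(fun f => σ.symm ∘ f) '' R, hiso _ _ σ.symm R hR, fun t => ?_, ?_⟩
  · obtain ⟨q, ⟨x, r, hr, hxl, hxr⟩, hq⟩ := hσR t
    refine ⟨x, ⟨r, hr, funext fun i => ?_⟩, hxl⟩
    simp only [Function.comp_apply]
    rw [Equiv.symm_apply_eq]
    exact (hq _ (hxr i)).symm
  · rintro _ ⟨r, hr, rfl⟩
    refine ⟨c 0, (hlim _ _).2 ?_⟩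
    let x := σ.symm ∘ r
    have hinj := he.eventually_eq_iff (Finset.univ.image x ∪ F.image c)
    have hcF : ∀ᶠ n in 𝓤, ∀ a ∈ F, e (c a) n = a := (eventually_all_finset F).2 fun a _ => hc a
    filter_upwards [hc 0, hinj, hcF] with n h0 hn hcF
    rw [h0]
    refine hK₀ n ⟨r, hr, fun i j => ?_, fun i hi => ?_⟩
    · have := hn (x i) (by simp) (x j) (by simp)
      simp only [x, Function.comp_apply] at this
      simp [this]
    · have key : ∀ a ∈ F, e (x i) n = a ↔ r i = a := by
        intro a ha
        have h1 := hn (x i) (by simp) (c a)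
          (Finset.mem_union_right _ (Finset.mem_image_of_mem _ ha))
        rw [hcF a ha] at h1
        rw [h1]
        simp only [x, Function.comp_apply]
        rw [Equiv.symm_apply_eq, hσc a ha]
      rcases hi with hi | hi
      · exact ((key _ hi).1 rfl).symm
      · exact (key _ hi).2 rfl

/-- The type of a tuple over `F`. -/
def typeOver {k : ℕ} (F : Finset ℕ) (x : Fin k → ℕ) : Set (Fin k × F) × Set (Fin k × Fin k) :=
  ({p | x p.1 = p.2}, {p | x p.1 = x p.2})

theorem typeOver_eq_iff {k : ℕ} {F : Finset ℕ} {x y : Fin k → ℕ} :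
    typeOver F x = typeOver F y ↔ EqvOver F x y := by
  simp only [typeOver, Prod.mk.injEq, Set.ext_iff, Prod.forall]
  constructor
  · rintro ⟨h1, h2⟩
    refine ⟨h2, fun i hi => ?_⟩
    rcases hi with hi | hi
    · exact ((h1 i ⟨_, hi⟩).1 rfl).symm
    · exact (h1 i ⟨_, hi⟩).2 rfl
  · rintro h
    refine ⟨fun i a => ⟨fun hx => ?_, fun hy => ?_⟩, h.1⟩
    · change x i = a at hx
      change y i = a
      rw [← h.2 i (Or.inl (hx ▸ a.2)), hx]
    · change y i = a at hy
      change x i = a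
      rw [h.2 i (Or.inr (hy ▸ a.2)), hy]

/-- `Z` is definable by equality with finitely many parameters. -/
def EqDefinable {k : ℕ} (Z : Set (Fin k → ℕ)) : Prop :=
  ∃ E : Finset ℕ, ∀ x y, EqvOver E x y → x ∈ Z → y ∈ Z

theorem countable_eqDefinable (k : ℕ) : {Z : Set (Fin k → ℕ) | EqDefinable Z}.Countable := by
  let f : (Σ E : Finset ℕ, Set (Set (Fin k × E) × Set (Fin k × Fin k))) → Set (Fin k → ℕ) :=
    fun P => {x | typeOver P.1 x ∈ P.2}
  have : ∀ E : Finset ℕ, Countable (Set (Set (Fin k × E) × Set (Fin k × Fin k))) :=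
    fun E => Finite.to_countable
  refine (Set.countable_range f).mono ?_
  rintro Z ⟨E, hE⟩
  refine ⟨⟨E, typeOver E '' Z⟩, ?_⟩
  ext x
  constructor
  · rintro ⟨y, hy, hyx⟩
    exact hE y x (typeOver_eq_iff.1 hyx) hy
  · exact fun hx => ⟨x, hx, rfl⟩

theorem EqDefinable.compl {k : ℕ} {Z : Set (Fin k → ℕ)} (h : EqDefinable Z) : EqDefinable Zᶜ :=
  let ⟨E, hE⟩ := h
  ⟨E, fun x y hxy hx hy => hx (hE y x hxy.symm hy)⟩

theorem EqDefinable.inter {k : ℕ} {Y Z : Set (Fin k → ℕ)} (h : EqDefinable Y)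
    (h' : EqDefinable Z) : EqDefinable (Y ∩ Z) :=
  let ⟨E, hE⟩ := h
  let ⟨E', hE'⟩ := h'
  ⟨E ∪ E', fun x y hxy hx => ⟨hE x y (hxy.mono Finset.subset_union_left) hx.1,
    hE' x y (hxy.mono Finset.subset_union_right) hx.2⟩⟩

theorem eqDefinable_typeClosure {k : ℕ} (F : Finset ℕ) (R : Set (Fin k → ℕ)) :
    EqDefinable (typeClosure F R) :=
  ⟨F, fun _ _ hxy ⟨r, hr, hxr⟩ => ⟨r, hr, hxy.symm.trans hxr⟩⟩

theorem eqDefinable_of_finite {k : ℕ} {Z : Set (Fin k → ℕ)} (h : Z.Finite) : EqDefinable Z := by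
  refine ⟨h.toFinset.biUnion fun x => Finset.univ.image x, fun x y hxy hx => ?_⟩
  have : x = y := funext fun i => hxy.2 i (Or.inl (Finset.mem_biUnion.2
    ⟨x, h.mem_toFinset.2 hx, Finset.mem_image_of_mem _ (Finset.mem_univ i)⟩))
  rwa [← this]

theorem EqDefinable.preimage_perm {k : ℕ} {Z : Set (Fin k → ℕ)} (h : EqDefinable Z)
    (ρ : Equiv.Perm ℕ) : EqDefinable {x | ρ ∘ x ∈ Z} := by
  obtain ⟨E, hE⟩ := h
  refine ⟨E.image ρ.symm, fun x y hxy hx => hE _ _ ⟨fun i j => ?_, fun i hi => ?_⟩ hx⟩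
  · simpa using hxy.1 i j
  · refine congrArg ρ (hxy.2 i (hi.imp ?_ ?_))
    · exact fun h => Finset.mem_image.2 ⟨_, h, by simp⟩
    · exact fun h => Finset.mem_image.2 ⟨_, h, by simp⟩

theorem subset_typeClosure {k : ℕ} (F : Finset ℕ) (R : Set (Fin k → ℕ)) :
    R ⊆ typeClosure F R := fun x hx => ⟨x, hx, EqvOver.refl F x⟩

theorem typeClosure_anti {k : ℕ} {F G : Finset ℕ} (h : F ⊆ G) (R : Set (Fin k → ℕ)) :
    typeClosure G R ⊆ typeClosure F R := fun _ ⟨r, hr, hx⟩ => ⟨r, hr, hx.mono h⟩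

/-- No coordinate of `x` lies in `G` outside `F`. -/
def Avoids {k : ℕ} (F G : Finset ℕ) (x : Fin k → ℕ) : Prop := ∀ i, x i ∈ G → x i ∈ F

theorem EqvOver.union_of_avoids {k : ℕ} {F G : Finset ℕ} {x y : Fin k → ℕ} (h : EqvOver F x y)
    (hx : Avoids F G x) (hy : Avoids F G y) : EqvOver (F ∪ G) x y := by
  refine ⟨h.1, fun i hi => h.2 i (hi.imp ?_ ?_)⟩
  · exact fun hm => (Finset.mem_union.1 hm).elim id (hx i)
  · exact fun hm => (Finset.mem_union.1 hm).elim id (hy i)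

/-- The type of `x` over `F` is realized in `R` outside every finite set. -/
def Rich {k : ℕ} (R : Set (Fin k → ℕ)) (F : Finset ℕ) (x : Fin k → ℕ) : Prop :=
  ∀ G : Finset ℕ, ∃ r ∈ R, EqvOver F x r ∧ Avoids F G r

theorem Rich.congr {k : ℕ} {R : Set (Fin k → ℕ)} {F : Finset ℕ} {x y : Fin k → ℕ}
    (h : Rich R F x) (hxy : EqvOver F x y) : Rich R F y := fun G =>
  let ⟨r, hr, hxr, hG⟩ := h G
  ⟨r, hr, hxy.symm.trans hxr, hG⟩

theorem exists_forall_rich {k : ℕ} (R : Set (Fin k → ℕ)) (F : Finset ℕ) :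
    ∃ F₁ : Finset ℕ, ∀ r ∈ R, Avoids F F₁ r → Rich R F r := by
  have h : ∀ τ : Set (Fin k × F) × Set (Fin k × Fin k), ∃ G : Finset ℕ,
      ∀ r ∈ R, typeOver F r = τ → Avoids F G r → Rich R F r := by
    intro τ
    by_cases hτ : ∀ r ∈ R, typeOver F r = τ → Rich R F r
    · exact ⟨∅, fun r hr ht _ => hτ r hr ht⟩
    · push Not at hτ
      obtain ⟨x, hx, hxτ, hnr⟩ := hτ
      unfold Rich at hnr
      push Not at hnr
      obtain ⟨G, hG⟩ := hnr
      exact ⟨G, fun r hr ht hav =>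
        absurd hav (hG r hr (typeOver_eq_iff.1 (hxτ.trans ht.symm)))⟩
  choose G hG using h
  have := Fintype.ofFinite (Set (Fin k × F) × Set (Fin k × Fin k))
  refine ⟨Finset.univ.biUnion G, fun r hr hav => hG _ r hr rfl fun i hi => hav i ?_⟩
  exact Finset.mem_biUnion.2 ⟨_, Finset.mem_univ _, hi⟩

/-- A sequence of tuples whose new coordinates are pairwise disjoint. -/
theorem exists_avoiding_sequence {k : ℕ} {P : (Fin k → ℕ) → Prop} (F F₁ : Finset ℕ)
    (h : ∀ G, F₁ ⊆ G → ∃ x, P x ∧ Avoids F G x) :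
    ∃ x : ℕ → Fin k → ℕ, (∀ j, P (x j) ∧ Avoids F F₁ (x j)) ∧
      ∀ i j, i < j → ∀ a b, x i a = x j b → x i a ∈ F := by
  choose! f hf using h
  let G : ℕ → Finset ℕ := fun n => Nat.rec F₁ (fun _ g => g ∪ Finset.univ.image (f g)) n
  have hG : ∀ n, G (n + 1) = G n ∪ Finset.univ.image (f (G n)) := fun n => rfl
  have hmono : Monotone G := monotone_nat_of_le_succ fun n => by
    rw [hG]; exact Finset.subset_union_left
  have hF₁ : ∀ n, F₁ ⊆ G n := fun n => hmono (Nat.zero_le n)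
  refine ⟨fun n => f (G n), fun j => ⟨(hf _ (hF₁ j)).1, fun i hi =>
    (hf _ (hF₁ j)).2 i (hF₁ j hi)⟩, fun i j hij a b hab => ?_⟩
  have hm : f (G i) a ∈ G j := hmono (Nat.succ_le_of_lt hij) (by
    rw [Nat.succ_eq_add_one, hG]
    exact Finset.mem_union_right _ (Finset.mem_image_of_mem _ (Finset.mem_univ a)))
  dsimp only at hab ⊢
  rw [hab] at hm ⊢
  exact (hf _ (hF₁ j)).2 b hm

theorem meets_of_sequence {k n : ℕ} {R : Set (Fin k → ℕ)} {F F₁ : Finset ℕ}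
    {x : ℕ → Fin k → ℕ} (hx : ∀ j, Rich R F (x j) ∧ Avoids F F₁ (x j))
    (hdis : ∀ i j, i < j → ∀ a b, x i a = x j b → x i a ∈ F) :
    Meets n R (F ∪ F₁) (x '' Set.Iic n) := by
  intro ρ hρ d hd
  have hρF : ∀ a ∈ F, ρ a = a := fun a ha => hρ a (Finset.mem_union_left _ ha)
  have hex : ∃ j ≤ n, Avoids F d (ρ ∘ x j) := by
    by_contra hcon
    push Not at hcon
    unfold Avoids at hcon
    push Not at hcon
    have : Nonempty (Fin k) := ⟨(hcon 0 (Nat.zero_le n)).choose⟩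
    choose! c hc using hcon
    have hinj : Set.InjOn (fun j => ρ (x j (c j))) (Finset.range (n + 1)) := by
      intro i hi j hj hij
      simp only [Finset.coe_range, Set.mem_Iio] at hi hj
      have hij' : x i (c i) = x j (c j) := ρ.injective hij
      by_contra hne
      rcases lt_or_gt_of_ne hne with hlt | hlt
      · have hmem := hdis i j hlt _ _ hij'
        apply (hc i (by omega)).2
        rw [Function.comp_apply, hρF _ hmem]
        exact hmem
      · have hmem := hdis j i hlt _ _ hij'.symm
        apply (hc j (by omega)).2
        rw [Function.comp_apply, hρF _ hmem]
        exact hmem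
    have := Finset.card_le_card_of_injOn (t := d) _ (fun j hj => by
      simp only [Finset.coe_range, Set.mem_Iio] at hj
      exact (hc j (by omega)).1) hinj
    rw [Finset.card_range] at this
    omega
  obtain ⟨j, hj, hav⟩ := hex
  refine ⟨x j, ⟨j, hj, rfl⟩, ?_⟩
  have hrich := (hx j).1.congr (EqvOver.perm hρF (x j)).symm
  obtain ⟨r, hr, hxr, hrav⟩ := hrich (F₁ ∪ d)
  refine ⟨r, hr, ?_⟩
  rw [Finset.union_assoc]
  refine hxr.union_of_avoids (fun i hi => ?_) hrav
  rcases Finset.mem_union.1 hi with hi | hi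
  · have h1 : x j i = ρ (x j i) := ρ.injective (hρ _ (Finset.mem_union_right _ hi)).symm
    have h2 := (hx j).2 i (h1 ▸ hi)
    rw [Function.comp_apply, ← h1]
    exact h2
  · exact hav i hi

/-- Every relation in `D` has a companion in `D` that is invariant over `F` away from a finite
set. -/
theorem exists_almost_invariant {k : ℕ} {D : DepPred k} (hiso : IsoClosed D) (hD : SFOd D)
    {R : Set (Fin k → ℕ)} (hR : D ℕ R) (F : Finset ℕ) :
    ∃ (S : Set (Fin k → ℕ)) (G : Finset ℕ), D ℕ S ∧
      (∀ x y, EqvOver F x y → Avoids F G x → Avoids F G y → x ∈ S → y ∈ S) ∧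
      S ⊆ typeClosure F R ∧ (∀ x, (∀ y, EqvOver F y x → y ∈ R) → x ∈ S) ∧
      ∀ Z, EqDefinable Z → S ⊆ Z → ∃ ρ : Equiv.Perm ℕ, ∀ r ∈ R, ρ ∘ r ∈ Z := by
  rcases R.eq_empty_or_nonempty with rfl | ⟨r₀, hr₀⟩
  · exact ⟨∅, ∅, hR, by simp, by simp, fun x hx => hx x (EqvOver.refl F x), fun Z _ _ => ⟨1, by simp⟩⟩
  obtain ⟨F₁, hF₁⟩ := exists_forall_rich R F
  let C := typeClosure (F ∪ F₁) R
  have hCperm : ∀ ρ : Equiv.Perm ℕ, (∀ a ∈ F ∪ F₁, ρ a = a) → ∀ r ∈ R, ρ.symm ∘ r ∈ C := by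
    intro ρ hρ r hr
    refine ⟨r, hr, EqvOver.perm (fun a ha => ?_) r⟩
    rw [Equiv.symm_apply_eq, hρ a ha]
  let 𝒦 : ℕ → Set (Set (Fin k → ℕ)) := fun n => {K | EqDefinable K ∧ K ⊆ C ∧ Meets n R (F ∪ F₁) K}
  have hC : ∀ n, C ∈ 𝒦 n := fun n => ⟨eqDefinable_typeClosure _ _, subset_rfl, fun ρ hρ d _ =>
    ⟨_, hCperm ρ hρ r₀ hr₀, subset_typeClosure _ _ (by
      convert hr₀; ext i; simp)⟩⟩
  have h𝒦 : ∀ n, ∃ f : ℕ → Set (Fin k → ℕ), 𝒦 n = Set.range f := fun n =>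
    ((countable_eqDefinable k).mono fun K hK => hK.1).exists_eq_range ⟨C, hC n⟩
  choose f hf using h𝒦
  have hf' : ∀ n t, f n t ∈ 𝒦 n := fun n t => by rw [hf]; exact ⟨t, rfl⟩
  have hfC : ∀ n t, (Nat.casesOn t C (f n) : Set (Fin k → ℕ)) ∈ 𝒦 n := by
    intro n t
    cases t with
    | zero => exact hC n
    | succ t => exact hf' n t
  obtain ⟨n, S, hS, hSK, hSC⟩ := exists_selection hiso hD hR (F ∪ F₁)
    (K := fun n t => Nat.casesOn t C (f n)) (fun n t => (hfC n t).2.2) (fun n => subset_rfl)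
  have hmeet : ∀ K ∈ 𝒦 n, (S ∩ K).Nonempty := by
    intro K hK
    rw [hf] at hK
    obtain ⟨t, rfl⟩ := hK
    exact hSK (t + 1)
  have hSC' : S ⊆ C := fun x hx => let ⟨t, ht⟩ := hSC x hx; (hfC n t).2.1 ht
  have hG : ∃ G, F₁ ⊆ G ∧ ∀ x, Rich R F x → Avoids F G x → x ∈ S := by
    by_contra hcon
    push Not at hcon
    obtain ⟨x, hx, hdis⟩ := exists_avoiding_sequence (P := fun x => Rich R F x ∧ x ∉ S) F F₁
      fun G hG => by
        obtain ⟨x, h1, h2, h3⟩ := hcon G hG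
        exact ⟨x, ⟨h1, h3⟩, h2⟩
    obtain ⟨_, hyS, j, -, rfl⟩ := hmeet (x '' Set.Iic n) ⟨eqDefinable_of_finite
      ((Set.finite_Iic n).image x), by
        rintro _ ⟨j, -, rfl⟩
        obtain ⟨r, hr, hxr, hav⟩ := (hx j).1.1 F₁
        exact ⟨r, hr, hxr.union_of_avoids (hx j).2 hav⟩,
      meets_of_sequence (fun j => ⟨(hx j).1.1, (hx j).2⟩) hdis⟩
    exact (hx j).1.2 hyS
  obtain ⟨G, hFG, hG⟩ := hG
  refine ⟨S, G, hS, fun x y hxy hx hy hxS => hG y ?_ hy,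
    hSC'.trans (typeClosure_anti Finset.subset_union_left R), fun x hx => ?_, fun Z hZ hSZ => ?_⟩
  · obtain ⟨r, hr, hxr⟩ := hSC' hxS
    refine ((hF₁ r hr fun i hi => ?_).congr
      (hxr.mono Finset.subset_union_left).symm).congr hxy
    have hxi := hxr.2 i (Or.inr (Finset.mem_union_right _ hi))
    rw [← hxi] at hi ⊢
    exact hx i (hFG hi)
  · obtain ⟨_, hxS, rfl⟩ := hmeet {x} ⟨eqDefinable_of_finite (Set.finite_singleton x),
      by rintro _ rfl; exact subset_typeClosure _ _ (hx _ (EqvOver.refl F _)),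
      fun ρ hρ d _ => ⟨x, rfl, subset_typeClosure _ _
        (hx _ (EqvOver.perm (fun a ha => hρ a (Finset.mem_union_left _ ha)) x))⟩⟩
    exact hxS
  · by_contra hcon
    push Not at hcon
    obtain ⟨x, hxS, hxZ, -⟩ := hmeet (Zᶜ ∩ C) ⟨hZ.compl.inter (eqDefinable_typeClosure _ _),
      Set.inter_subset_right, fun ρ hρ d _ => by
        obtain ⟨r, hr, hrZ⟩ := hcon ρ.symm
        exact ⟨_, ⟨hrZ, hCperm ρ hρ r hr⟩, subset_typeClosure _ _ (by
          convert hr; ext i; simp)⟩⟩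
    exact hxZ (hSZ hxS)

theorem exists_partially_invariant {k : ℕ} {D : DepPred k} (hiso : IsoClosed D) (hD : SFOd D)
    {R : Set (Fin k → ℕ)} (hR : D ℕ R) (F : Finset ℕ) (j : ℕ) :
    ∃ (S : Set (Fin k → ℕ)) (E : Finset ℕ), F ⊆ E ∧ D ℕ S ∧
      (∀ x y, EqvOver E x y → (Finset.univ.filter fun i => x i ∈ E).card < j → x ∈ S → y ∈ S) ∧
      S ⊆ typeClosure F R ∧
      ∀ Z, EqDefinable Z → S ⊆ Z → ∃ ρ : Equiv.Perm ℕ, ∀ r ∈ R, ρ ∘ r ∈ Z := by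
  induction j with
  | zero =>
    exact ⟨R, F, subset_rfl, hR, by simp, subset_typeClosure F R, fun Z _ hRZ => ⟨1, hRZ⟩⟩
  | succ j ih =>
    obtain ⟨S, E, hFE, hS, hinv, hSR, hSZ⟩ := ih
    obtain ⟨T, G, hT, hTinv, hTS, hST, hTZ⟩ := exists_almost_invariant hiso hD hS E
    refine ⟨T, E ∪ G, hFE.trans Finset.subset_union_left, hT, fun x y hxy hcard hxT => ?_,
      fun x hx => ?_, fun Z hZ hTZ' => ?_⟩
    · by_cases hav : Avoids E G x
      · refine hTinv x y (hxy.mono Finset.subset_union_left) hav (fun i hi => ?_) hxT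
        have hxi := hxy.2 i (Or.inr (Finset.mem_union_right _ hi))
        rw [← hxi] at hi ⊢
        exact hav i hi
      · unfold Avoids at hav
        push Not at hav
        obtain ⟨i, hiG, hiE⟩ := hav
        have hlt : (Finset.univ.filter fun i => x i ∈ E).card < j := by
          refine lt_of_lt_of_le (Finset.card_lt_card (Finset.ssubset_iff_subset_ne.2
            ⟨fun l hl => ?_, fun heq => ?_⟩)) (Nat.lt_succ_iff.1 hcard)
          · simp only [Finset.mem_filter, Finset.mem_univ, true_and, Finset.mem_union] at hl ⊢
            exact Or.inl hl
          · have : i ∈ Finset.univ.filter fun i => x i ∈ E := by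
              rw [heq]; simp [hiG]
            exact hiE (by simpa using this)
        obtain ⟨r, hr, hxr⟩ := hTS hxT
        have hmemeq : ∀ z, EqvOver E x z →
            (Finset.univ.filter fun i => z i ∈ E) = Finset.univ.filter fun i => x i ∈ E :=
          fun z hz => Finset.filter_congr fun i _ => (hz.mem_iff i).symm
        refine hST y fun z hz => hinv r z ?_ (by rwa [hmemeq r hxr]) hr
        exact hxr.symm.trans ((hxy.mono Finset.subset_union_left).trans hz.symm)
    · obtain ⟨s, hs, hxs⟩ := hTS hx
      obtain ⟨r, hr, hsr⟩ := hSR hs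
      exact ⟨r, hr, (hxs.mono hFE).trans hsr⟩
    · obtain ⟨ρ, hρ⟩ := hTZ Z hZ hTZ'
      obtain ⟨ρ', hρ'⟩ := hSZ _ (hZ.preimage_perm ρ) hρ
      exact ⟨ρ * ρ', fun r hr => hρ' r hr⟩

theorem exists_eqDefinable {k : ℕ} {D : DepPred k} (hiso : IsoClosed D) (hD : SFOd D)
    {R : Set (Fin k → ℕ)} (hR : D ℕ R) (F : Finset ℕ) :
    ∃ S : Set (Fin k → ℕ), EqDefinable S ∧ D ℕ S ∧ S ⊆ typeClosure F R ∧
      ∃ ρ : Equiv.Perm ℕ, ∀ r ∈ R, ρ ∘ r ∈ S := by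
  obtain ⟨S, E, -, hS, hinv, hSR, hSZ⟩ := exists_partially_invariant hiso hD hR F (k + 1)
  have hdef : EqDefinable S := ⟨E, fun x y hxy => hinv x y hxy
    (Nat.lt_succ_of_le ((Finset.card_le_univ _).trans (by simp)))⟩
  exact ⟨S, hdef, hS, hSR, hSZ S hdef subset_rfl⟩

theorem IsoClosed.complD {k : ℕ} {D : DepPred k} (hiso : IsoClosed D) : IsoClosed (complD D) := by
  intro M N e R hR hN
  apply hR
  have h := hiso N M e.symm _ hN
  rw [Set.image_image] at h
  convert h
  ext x
  simp [← Function.comp_assoc]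

theorem exists_eqDefinable_subset {k : ℕ} {D : DepPred k} (hiso : IsoClosed D) (hD : SFOd D)
    {R Z : Set (Fin k → ℕ)} (hR : D ℕ R) (hZ : EqDefinable Z)
    (hRZ : ∃ ρ : Equiv.Perm ℕ, ∀ r ∈ R, ρ ∘ r ∈ Z) :
    ∃ S ⊆ Z, EqDefinable S ∧ D ℕ S ∧ ∃ ρ : Equiv.Perm ℕ, ∀ r ∈ R, ρ ∘ r ∈ S := by
  obtain ⟨E, hE⟩ := hZ
  obtain ⟨ρ, hρ⟩ := hRZ
  obtain ⟨S, hS, hDS, hSR, ρ', hρ'⟩ := exists_eqDefinable hiso hD (hiso _ _ ρ R hR) E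
  refine ⟨S, fun x hx => ?_, hS, hDS, ρ' * ρ, fun r hr => hρ' _ ⟨r, hr, rfl⟩⟩
  obtain ⟨_, ⟨r, hr, rfl⟩, hxr⟩ := hSR hx
  exact hE _ _ hxr.symm (hρ r hr)

theorem not_exists_iUnion_of_antitone {k : ℕ} {D : DepPred k} {V : ℕ → Set (Fin k → ℕ)}
    (hV : Antitone V) (hD : ∀ n, ¬ D ℕ (V n)) :
    ¬ ∃ J : Set ℕ, J.Nonempty ∧ D ℕ {x | ∃ t ∈ J, x ∈ V t} := by
  classical
  rintro ⟨J, hJ, h⟩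
  apply hD (sInf J)
  convert h
  ext x
  exact ⟨fun hx => ⟨_, Nat.sInf_mem hJ, hx⟩, fun ⟨t, ht, hx⟩ => hV (Nat.sInf_le ht) hx⟩

/-- The sentence of `SFOd.exists_sentence_iUnion` fails in a limit if it fails everywhere. -/
theorem SFOd.exists_limit_not_iUnion {k : ℕ} {D : DepPred k} (hD : SFOd D) (N : ℕ → Type)
    [∀ n, Nontrivial (N n)] (V : ∀ n, N n → Set (Fin k → N n))
    (hV : ∀ n, ¬ ∃ J : Set (N n), J.Nonempty ∧ D (N n) {x | ∃ t ∈ J, x ∈ V n t}) :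
    ∃ 𝒢 : Set (List (∀ n, N n) → ∀ n, N n), 𝒢.Countable ∧
      ∀ e : ℕ → ∀ n, N n, IsLimit 𝒢 e → ∀ J : Set ℕ, J.Nonempty →
        ¬ D ℕ {x | ∃ t ∈ J, ∀ᶠ n in 𝓤, (fun i => e (x i) n) ∈ V n (e t n)} := by
  obtain ⟨ψ, hψ, h⟩ := hD.exists_sentence_iUnion
  let L : ∀ n, Set (Fin (k + 1) → N n) := fun n => {y | Fin.tail y ∈ V n (y 0)}
  have hL : ∀ n t x, (Fin.cons t x : Fin (k + 1) → N n) ∈ L n ↔ x ∈ V n t := by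
    intro n t x
    simp [L]
  obtain ⟨𝒢, h𝒢, hlos⟩ := los_sentence hψ N L
  refine ⟨𝒢, h𝒢, fun e he J hJ hDJ => ?_⟩
  have hlim : ∀ t x, (Fin.cons t x : Fin (k + 1) → ℕ) ∈ limRel e L ↔
      ∀ᶠ n in 𝓤, (fun i => e (x i) n) ∈ V n (e t n) := by
    intro t x
    refine eventually_congr (Eventually.of_forall fun n => ?_)
    rw [← hL]
    refine iff_of_eq (congrArg (· ∈ L n) (funext fun i => ?_))
    refine Fin.cases ?_ (fun j => ?_) i <;> simp
  have htrue : FOTrue ℕ (interpR (limRel e L)) ψ := by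
    rw [h ℕ inferInstance]
    refine ⟨J, hJ, ?_⟩
    simp only [hlim]
    exact hDJ
  rw [hlos e he] at htrue
  obtain ⟨n, hn⟩ := htrue.exists
  rw [h (N n) inferInstance] at hn
  simp only [hL] at hn
  exact hV n hn

theorem not_of_same_eqDefinable {k : ℕ} {D : DepPred k} (hiso : IsoClosed D) (hD : SFOd D)
    (hnD : SFOd (complD D)) {R Q : Set (Fin k → ℕ)} (hR : D ℕ R) (hQ : ¬ D ℕ Q)
    (hRQ : ∀ Z, EqDefinable Z →
      ((∃ ρ : Equiv.Perm ℕ, ∀ r ∈ R, ρ ∘ r ∈ Z) ↔ ∃ ρ : Equiv.Perm ℕ, ∀ q ∈ Q, ρ ∘ q ∈ Z)) :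
    False := by
  let 𝒵 := {Z : Set (Fin k → ℕ) // EqDefinable Z ∧ ∃ ρ : Equiv.Perm ℕ, ∀ r ∈ R, ρ ∘ r ∈ Z}
  have hw : ∀ Z : 𝒵, ∃ W : 𝒵, W.1 ⊆ Z.1 ∧ D ℕ W.1 := by
    rintro ⟨Z, hZ, hZR⟩
    obtain ⟨W, hWZ, hW, hDW, hWR⟩ := exists_eqDefinable_subset hiso hD hR hZ hZR
    exact ⟨⟨W, hW, hWR⟩, hWZ, hDW⟩
  have hv : ∀ Z : 𝒵, ∃ W : 𝒵, W.1 ⊆ Z.1 ∧ ¬ D ℕ W.1 := by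
    rintro ⟨Z, hZ, hZR⟩
    obtain ⟨W, hWZ, hW, hDW, hWR⟩ :=
      exists_eqDefinable_subset hiso.complD hnD hQ hZ ((hRQ Z hZ).1 hZR)
    exact ⟨⟨W, hW, (hRQ W hW).2 hWR⟩, hWZ, hDW⟩
  choose w hwZ hwD using hw
  choose v hvZ hvD using hv
  let Z : ℕ → 𝒵 := fun n => Nat.rec ⟨Set.univ, ⟨∅, by simp⟩, 1, by simp⟩ (fun _ Y => v (w Y)) n
  have hZ : ∀ n, Z (n + 1) = v (w (Z n)) := fun n => rfl
  let W : ℕ → Set (Fin k → ℕ) := fun n => (w (Z n)).1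
  let V : ℕ → Set (Fin k → ℕ) := fun n => (Z (n + 1)).1
  have hVW : ∀ n, V n ⊆ W n := fun n => hvZ _
  have hWV : ∀ n, W (n + 1) ⊆ V n := fun n => hwZ _
  have hVa : Antitone V := antitone_nat_of_succ_le fun n => (hVW (n + 1)).trans (hWV n)
  have hWa : Antitone W := antitone_nat_of_succ_le fun n => (hWV n).trans (hVW n)
  obtain ⟨𝒢, h𝒢, hlV⟩ := hD.exists_limit_not_iUnion (fun _ => ℕ) (fun _ => V)
    fun _ => not_exists_iUnion_of_antitone hVa fun n => hvD _
  obtain ⟨ℋ, hℋ, hlW⟩ := hnD.exists_limit_not_iUnion (fun _ => ℕ) (fun _ => W)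
    fun _ => not_exists_iUnion_of_antitone hWa fun n => not_not_intro (hwD _)
  let pred : List (ℕ → ℕ) → ℕ → ℕ := fun l n => l.headD 0 n - 1
  let diag : List (ℕ → ℕ) → ℕ → ℕ := fun _ n => n
  obtain ⟨e, he⟩ := exists_isLimit (N := fun _ => ℕ)
    ((h𝒢.union hℋ).union (Set.toFinite {pred, diag}).countable) (fun i _ => i) (by simp)
  have he1 := he.mono (Set.subset_union_left.trans Set.subset_union_left)
  have he2 := he.mono (Set.subset_union_right.trans Set.subset_union_left)
  let J : Set ℕ := {a | ∀ m, ∀ᶠ n in 𝓤, m < e a n}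
  have hJ : J.Nonempty := by
    obtain ⟨a, ha⟩ := he.closed diag (Or.inr (by simp)) []
    refine ⟨a, fun m => ?_⟩
    have h : ∀ᶠ n in 𝓤, m < n := Nat.hyperfilter_le_atTop (eventually_gt_atTop m)
    filter_upwards [ha, h] with n h1 h2
    rw [h1]
    exact h2
  apply hlW e he2 J hJ
  rw [DSFO.complD]
  convert hlV e he1 J hJ using 2
  ext x
  constructor
  · rintro ⟨a, haJ, ha⟩
    obtain ⟨b, hb⟩ := he.closed pred (Or.inr (by simp)) [a]
    replace hb : ∀ᶠ n in 𝓤, e b n = e a n - 1 := hb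
    refine ⟨b, fun m => ?_, ?_⟩
    · filter_upwards [hb, haJ (m + 1)] with n h1 h2
      omega
    · filter_upwards [ha, hb, haJ 0] with n h1 h2 h3
      rw [h2]
      refine hWV _ ?_
      rwa [Nat.sub_add_cancel h3]
  · rintro ⟨a, haJ, ha⟩
    exact ⟨a, haJ, ha.mono fun n hn => hVW _ hn⟩

/-! ### Patterns -/

/-- The equality type of `x` relative to the parameters `a`. -/
def paramType {M : Type} {k m : ℕ} (a : Fin m → M) (x : Fin k → M) :
    Set (Fin k × Fin m) × Set (Fin k × Fin k) :=
  ({p | x p.1 = a p.2}, {p | x p.1 = x p.2})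

theorem paramType_eq_iff {M N : Type} {k m : ℕ} {a : Fin m → M} {x : Fin k → M} {b : Fin m → N}
    {y : Fin k → N} : paramType a x = paramType b y ↔
      (∀ i j, x i = a j ↔ y i = b j) ∧ ∀ i j, x i = x j ↔ y i = y j := by
  simp only [paramType, Prod.mk.injEq, Set.ext_iff, Prod.forall]
  rfl

theorem paramType_comp {M N : Type} {k m : ℕ} {f : M → N} (hf : Function.Injective f)
    (a : Fin m → M) (x : Fin k → M) : paramType (f ∘ a) (f ∘ x) = paramType a x :=
  paramType_eq_iff.2 ⟨fun _ _ => hf.eq_iff, fun _ _ => hf.eq_iff⟩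

/-- For suitable distinct parameters, all tuples of `R` have type in `P`. -/
def HasPattern {M : Type} {k m : ℕ} (P : Set (Set (Fin k × Fin m) × Set (Fin k × Fin k)))
    (R : Set (Fin k → M)) : Prop :=
  ∃ a : Fin m → M, Function.Injective a ∧ ∀ x ∈ R, paramType a x ∈ P

theorem HasPattern.image_equiv {M N : Type} {k m : ℕ}
    {P : Set (Set (Fin k × Fin m) × Set (Fin k × Fin k))} {R : Set (Fin k → M)} (e : M ≃ N)
    (h : HasPattern P R) : HasPattern P ((fun f => e ∘ f) '' R) := by
  obtain ⟨a, ha, haP⟩ := h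
  refine ⟨e ∘ a, e.injective.comp ha, ?_⟩
  rintro _ ⟨x, hx, rfl⟩
  rw [paramType_comp e.injective]
  exact haP x hx

theorem hasPattern_image_equiv {M N : Type} {k m : ℕ}
    {P : Set (Set (Fin k × Fin m) × Set (Fin k × Fin k))} {R : Set (Fin k → M)} (e : M ≃ N) :
    HasPattern P ((fun f => e ∘ f) '' R) ↔ HasPattern P R := by
  refine ⟨fun h => ?_, HasPattern.image_equiv e⟩
  have := h.image_equiv e.symm
  rw [Set.image_image] at this
  convert this
  ext x
  simp [← Function.comp_assoc]

theorem EqDefinable.exists_pattern {k : ℕ} {Z : Set (Fin k → ℕ)} (hZ : EqDefinable Z) :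
    ∃ (m : ℕ) (P : Set (Set (Fin k × Fin m) × Set (Fin k × Fin k))),
      ∀ R : Set (Fin k → ℕ), (∃ ρ : Equiv.Perm ℕ, ∀ r ∈ R, ρ ∘ r ∈ Z) ↔ HasPattern P R := by
  obtain ⟨E, hE⟩ := hZ
  let c : Fin E.card → ℕ := fun i => E.equivFin.symm i
  have hc : Function.Injective c := Subtype.val_injective.comp E.equivFin.symm.injective
  have hcE : ∀ a ∈ E, ∃ i, c i = a := fun a ha => ⟨E.equivFin ⟨a, ha⟩, by simp [c]⟩
  refine ⟨E.card, paramType c '' Z, fun R => ⟨?_, ?_⟩⟩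
  · rintro ⟨ρ, hρ⟩
    refine ⟨ρ.symm ∘ c, ρ.symm.injective.comp hc, fun x hx => ⟨_, hρ x hx, ?_⟩⟩
    rw [← paramType_comp ρ.symm.injective]
    congr 1
    ext i; simp
  · rintro ⟨a, ha, haP⟩
    obtain ⟨ρ, hρ⟩ := extendable_of_eq_iff (p := Finset.univ.image fun i => (a i, c i)) (by
      intro u hu v hv
      obtain ⟨i, -, rfl⟩ := Finset.mem_image.1 hu
      obtain ⟨j, -, rfl⟩ := Finset.mem_image.1 hv
      exact (ha.eq_iff).trans hc.eq_iff.symm)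
    have hρa : c = ρ ∘ a := funext fun i =>
      (hρ _ (Finset.mem_image_of_mem (fun i => (a i, c i)) (Finset.mem_univ i))).symm
    refine ⟨ρ, fun r hr => ?_⟩
    obtain ⟨z, hz, hzr⟩ := haP r hr
    rw [← paramType_comp ρ.injective a r, ← hρa] at hzr
    obtain ⟨h1, h2⟩ := paramType_eq_iff.1 hzr
    refine hE z _ ⟨h2, fun i hi => ?_⟩ hz
    rcases hi with hi | hi
    · obtain ⟨j, hj⟩ := hcE _ hi
      rw [← hj, eq_comm, ← h1 i j, hj]
    · obtain ⟨j, hj⟩ := hcE _ hi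
      rw [← hj, h1 i j, hj]

theorem exists_limit_hasPattern {k : ℕ} (N : ℕ → Type) [∀ n, Nonempty (N n)]
    (Q : ∀ n, Set (Fin k → N n)) {m : ℕ} (P : Set (Set (Fin k × Fin m) × Set (Fin k × Fin k))) :
    ∃ 𝒢 : Set (List (∀ n, N n) → ∀ n, N n), 𝒢.Countable ∧
      ∀ e : ℕ → ∀ n, N n, IsLimit 𝒢 e →
        (HasPattern P (limRel e Q) ↔ ∀ᶠ n in 𝓤, HasPattern P (Q n)) := by
  let W : ∀ n, (Fin m → N n) → Prop := fun n a => Function.Injective a ∧ ∀ x ∈ Q n, paramType a x ∈ P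
  let g : Fin m → List (∀ n, N n) → ∀ n, N n := fun i _ n => Classical.epsilon (W n) i
  let B : ∀ n, (Fin m → N n) → (Fin k → N n) → Prop := fun n a x => x ∈ Q n ∧ paramType a x ∉ P
  let h : Fin k → List (∀ n, N n) → ∀ n, N n := fun i l n =>
    Classical.epsilon (B n fun j => l.getD j (fun _ => Classical.arbitrary _) n) i
  refine ⟨Set.range g ∪ Set.range h, (Set.countable_range g).union (Set.countable_range h),
    fun e he => ?_⟩
  have htype : ∀ (a : Fin m → ℕ) (x : Fin k → ℕ), ∀ᶠ n in 𝓤,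
      paramType (fun i => e (a i) n) (fun i => e (x i) n) = paramType a x := by
    intro a x
    refine (he.eventually_eq_iff (Finset.univ.image a ∪ Finset.univ.image x)).mono fun n hn => ?_
    exact paramType_eq_iff.2 ⟨fun i j => hn _ (by simp) _ (by simp),
      fun i j => hn _ (by simp) _ (by simp)⟩
  constructor
  · rintro ⟨a, ha, haP⟩
    by_contra hcon
    rw [← Ultrafilter.eventually_not] at hcon
    have hx : ∀ i, ∃ b, ∀ᶠ n in 𝓤, e b n =
        Classical.epsilon (B n fun j => e (a j) n) i := by
      intro i
      obtain ⟨b, hb⟩ := he.closed (h i) (Or.inr ⟨i, rfl⟩) (List.ofFn a)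
      refine ⟨b, hb.mono fun n hn => hn.trans ?_⟩
      simp [h, List.getD]
    choose x hx using hx
    have hB : ∀ᶠ n in 𝓤, B n (fun j => e (a j) n) fun i => e (x i) n := by
      filter_upwards [hcon, eventually_all.2 hx, he.eventually_eq_iff (Finset.univ.image a)]
        with n h1 h2 h3
      rw [show (fun i => e (x i) n) = _ from funext h2]
      apply Classical.epsilon_spec (p := B n fun j => e (a j) n)
      by_contra hne
      refine h1 ⟨fun j => e (a j) n, fun i j hij => ha ((h3 _ (by simp) _ (by simp)).1 hij),
        fun x hx => ?_⟩
      by_contra hP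
      exact hne ⟨x, hx, hP⟩
    have hxQ : x ∈ limRel e Q := hB.mono fun n hn => hn.1
    obtain ⟨n, hn, ht⟩ := (hB.and (htype a x)).exists
    apply hn.2
    rw [ht]
    exact haP x hxQ
  · intro hev
    have hx : ∀ i, ∃ b, ∀ᶠ n in 𝓤, e b n = Classical.epsilon (W n) i :=
      fun i => he.closed (g i) (Or.inl ⟨i, rfl⟩) []
    choose a ha using hx
    have hW : ∀ᶠ n in 𝓤, W n fun i => e (a i) n := by
      filter_upwards [hev, eventually_all.2 ha] with n h1 h2
      rw [show (fun i => e (a i) n) = _ from funext h2]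
      exact Classical.epsilon_spec (p := W n) h1
    refine ⟨a, fun i j hij => ?_, fun x hx => ?_⟩
    · obtain ⟨n, hn⟩ := hW.exists
      exact hn.1 (show e (a i) n = e (a j) n by rw [hij])
    · obtain ⟨n, ⟨h1, h2⟩, h3⟩ := ((hW.and hx).and (htype a x)).exists
      rw [← h3]
      exact h1.2 _ h2

/-- If `D` holds at `R` then it holds at all large `Q` with the same patterns. -/
theorem exists_bound_of_same_patterns {k : ℕ} {D : DepPred k} (hiso : IsoClosed D) (hD : SFOd D)
    (hnD : SFOd (complD D)) {R : Set (Fin k → ℕ)} (hR : D ℕ R) :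
    ∃ j : ℕ, ∀ N : Type, Nontrivial N → ∀ Q : Set (Fin k → N),
      (∃ a : Fin j → N, Function.Injective a) →
      (∀ m ≤ j, ∀ P : Set (Set (Fin k × Fin m) × Set (Fin k × Fin k)),
        HasPattern P Q ↔ HasPattern P R) → D N Q := by
  by_contra hcon
  push Not at hcon
  choose N hN Q ha hP hDQ using hcon
  choose a ha using ha
  obtain ⟨𝒢, h𝒢, hlim⟩ := hD.exists_limit_not_iUnion N (fun n _ => Q n) fun n ⟨J, ⟨t, ht⟩, hJ⟩ =>
    hDQ n (by
      convert hJ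
      ext x
      exact ⟨fun hx => ⟨t, ht, hx⟩, fun ⟨_, _, hx⟩ => hx⟩)
  choose ℋ hℋ hpat using fun P : Σ m : ℕ, Set (Set (Fin k × Fin m) × Set (Fin k × Fin k)) =>
    exists_limit_hasPattern N Q P.2
  have : ∀ m, Countable (Set (Set (Fin k × Fin m) × Set (Fin k × Fin k))) :=
    fun m => Finite.to_countable
  obtain ⟨e, he⟩ := exists_isLimit (h𝒢.union (Set.countable_iUnion hℋ))
    (fun i n => if h : i < n then a n ⟨i, h⟩ else Classical.arbitrary _) (by
      intro i j hij
      have hlt : ∀ᶠ n in 𝓤, max i j < n := Nat.hyperfilter_le_atTop (eventually_gt_atTop _)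
      obtain ⟨n, h1, h2⟩ := (hij.and hlt).exists
      have hi : i < n := (le_max_left _ _).trans_lt h2
      have hj : j < n := (le_max_right _ _).trans_lt h2
      simp only [hi, hj, dif_pos] at h1
      simpa using ha n h1)
  have hnQ := hlim e (he.mono Set.subset_union_left) Set.univ Set.univ_nonempty
  refine not_of_same_eqDefinable hiso hD hnD hR (Q := limRel e Q) (fun h => hnQ ?_) fun Z hZ => ?_
  · convert h
    ext x
    simp [limRel]
  · obtain ⟨m, P, hmP⟩ := hZ.exists_pattern
    rw [hmP, hmP, hpat ⟨m, P⟩ e (he.mono ((Set.subset_iUnion ℋ ⟨m, P⟩).trans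
      Set.subset_union_right))]
    have hge : ∀ᶠ n in 𝓤, m ≤ n := Nat.hyperfilter_le_atTop (eventually_ge_atTop m)
    constructor
    · exact fun h => hge.mono fun n hn => (hP n m hn P).2 h
    · intro h
      obtain ⟨n, h1, h2⟩ := (h.and hge).exists
      exact (hP n m h2 P).1 h1

/-! ### Expressing patterns by formulas -/

theorem FSat_exs {S : Signature} {ι : Type} {ar : ι → ℕ} {M : Type} (I : Interp S M)
    (φ : TS S ι ar) (l : List ℕ) (s : ℕ → M) :
    FSat M I s (exs l φ) ↔ ∃ s' : ℕ → M, (∀ w ∉ l, s' w = s w) ∧ FSat M I s' φ := by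
  induction l generalizing s with
  | nil =>
    constructor
    · exact fun h => ⟨s, fun _ _ => rfl, h⟩
    · rintro ⟨s', hs', h⟩
      rwa [← show s' = s from funext fun w => hs' w (by simp)]
  | cons v l ih =>
    change (∃ m, FSat M I (Function.update s v m) (exs l φ)) ↔ _
    simp only [ih]
    constructor
    · rintro ⟨m, s', hs', h⟩
      refine ⟨s', fun w hw => ?_, h⟩
      simp only [List.mem_cons, not_or] at hw
      rw [hs' w hw.2, Function.update_of_ne hw.1]
    · rintro ⟨s', hs', h⟩
      refine ⟨s' v, s', fun w hw => ?_, h⟩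
      by_cases hwv : w = v
      · simp [hwv]
      · rw [Function.update_of_ne hwv]
        exact hs' w (by simp [hwv, hw])

theorem exists_formula_of_equalities (L : List (ℕ × ℕ)) (A : Set (ℕ × ℕ) → Prop) :
    ∃ θ : EF, ∀ (M : Type) (s : ℕ → M),
      FSat M (eI M) s θ ↔ A {p | p ∈ L ∧ s p.1 = s p.2} := by
  induction L generalizing A with
  | nil =>
    by_cases hA : A ∅
    · exact ⟨.eq 0 0, fun M s => by simp [FSat, hA]⟩
    · exact ⟨.neq 0 0, fun M s => by simp [FSat, hA]⟩
  | cons p L ih =>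
    obtain ⟨θ, hθ⟩ := ih fun T => A (insert p T)
    obtain ⟨θ', hθ'⟩ := ih A
    refine ⟨.or (.and (.eq p.1 p.2) θ) (.and (.neq p.1 p.2) θ'), fun M s => ?_⟩
    simp only [FSat, hθ, hθ']
    by_cases hp : s p.1 = s p.2
    · have : {q | q ∈ p :: L ∧ s q.1 = s q.2} = insert p {q | q ∈ L ∧ s q.1 = s q.2} := by
        ext q
        simp only [List.mem_cons, Set.mem_insert_iff, Set.mem_ofPred_eq]
        constructor
        · tauto
        · rintro (rfl | h)
          exacts [⟨Or.inl rfl, hp⟩, ⟨Or.inr h.1, h.2⟩]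
      rw [this]
      simp [hp]
    · have : {q | q ∈ p :: L ∧ s q.1 = s q.2} = {q | q ∈ L ∧ s q.1 = s q.2} := by
        ext q
        simp only [List.mem_cons, Set.mem_ofPred_eq]
        constructor
        · rintro ⟨rfl | h, h'⟩
          exacts [absurd h' hp, ⟨h, h'⟩]
        · exact fun h => ⟨Or.inr h.1, h.2⟩
      rw [this]
      simp [hp]

theorem exists_formula_paramType {k m : ℕ}
    (P : Set (Set (Fin k × Fin m) × Set (Fin k × Fin k))) :
    ∃ θ : EF, ∀ (M : Type) (s : ℕ → M), FSat M (eI M) s θ ↔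
      Function.Injective (fun i : Fin m => s (k + i)) ∧
        paramType (fun i : Fin m => s (k + i)) (fun i : Fin k => s i) ∈ P := by
  obtain ⟨θ, hθ⟩ := exists_formula_of_equalities ((List.range (k + m)).product (List.range (k + m)))
    fun T => (∀ i j : Fin m, (k + (i : ℕ), k + (j : ℕ)) ∈ T → i = j) ∧
      (({p : Fin k × Fin m | ((p.1 : ℕ), k + (p.2 : ℕ)) ∈ T},
        {p : Fin k × Fin k | ((p.1 : ℕ), (p.2 : ℕ)) ∈ T}) :
          Set (Fin k × Fin m) × Set (Fin k × Fin k)) ∈ P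
  have hlt : ∀ i : Fin k, (i : ℕ) < k + m := fun i => by omega
  refine ⟨θ, fun M s => ?_⟩
  rw [hθ]
  simp [paramType, Function.Injective, hlt]

theorem exists_formula_hasPattern {k m : ℕ}
    (P : Set (Set (Fin k × Fin m) × Set (Fin k × Fin k))) :
    ∃ θ : EF, ∀ (M : Type) (R : Set (Fin k → M)), (∃ a : Fin m → M, Function.Injective a) →
      Nonempty M → (ExAllSem M R θ ↔ HasPattern P R) := by
  obtain ⟨θ, hθ⟩ := exists_formula_paramType P
  refine ⟨θ, fun M R hM ⟨d⟩ => ?_⟩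
  have hle : ∀ (f : Fin k → M) (s : ℕ → M), (fun i : Fin k => overrideFin k f s i) = f := by
    intro f s; ext i; simp [overrideFin]
  have hge : ∀ (f : Fin k → M) (s : ℕ → M),
      (fun i : Fin m => overrideFin k f s (k + i)) = fun i : Fin m => s (k + i) := by
    intro f s; ext i; simp [overrideFin]
  simp only [ExAllSem, hθ, hle, hge]
  constructor
  · rintro ⟨s, hs⟩
    rcases R.eq_empty_or_nonempty with rfl | ⟨r, hr⟩
    · obtain ⟨a, ha⟩ := hM
      exact ⟨a, ha, by simp⟩
    · exact ⟨_, (hs r hr).1, fun x hx => (hs x hx).2⟩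
  · rintro ⟨a, ha, haP⟩
    refine ⟨fun v => if h : v - k < m then a ⟨v - k, h⟩ else d, fun x hx => ?_⟩
    have : (fun i : Fin m => if h : k + (i : ℕ) - k < m then a ⟨k + (i : ℕ) - k, h⟩ else d) = a := by
      ext i; simp
    rw [this]
    exact ⟨ha, haP x hx⟩

theorem exists_sentence_card_ge (m : ℕ) :
    ∃ ψ : EF, IsSentence ψ ∧ ∀ M : Type, Nonempty M →
      (FOTrue M (eI M) ψ ↔ ∃ a : Fin m → M, Function.Injective a) := by
  obtain ⟨θ, hθ⟩ := exists_formula_paramType (k := 0) (m := m) Set.univ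
  obtain ⟨b, hb⟩ := fv_bddAbove θ
  have hs : IsSentence (exs (List.range (b + 1 + m)) θ) := by
    rw [IsSentence, fv_exs, Set.eq_empty_iff_forall_notMem]
    rintro v ⟨hv, hv'⟩
    have := hb hv
    rw [List.mem_range] at hv'
    omega
  refine ⟨_, hs, fun M ⟨d⟩ => ?_⟩
  rw [FOTrue_iff_FSat _ hs fun _ => d, FSat_exs]
  simp only [hθ, Set.mem_univ, and_true, Nat.zero_add]
  constructor
  · rintro ⟨s, -, h⟩
    exact ⟨_, h⟩
  · rintro ⟨a, ha⟩
    refine ⟨fun v => if h : v < m then a ⟨v, h⟩ else d, fun w hw => ?_, ?_⟩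
    · rw [List.mem_range] at hw
      exact dif_neg (by omega)
    · convert ha using 2
      rename_i i
      simp

/-! ### The sentence `η` -/

/-- Finitely many existential-universal conditions, up to equivalence, yield a sentence `η`. -/
theorem exists_eta_of_finite {k : ℕ} {D : DepPred k} {M : Type} {R : Set (Fin k → M)}
    {ι : Type} [Finite ι] (θ : ι → EF) {ψ : EF} (hψ : IsSentence ψ) (hψM : FOTrue M (eI M) ψ)
    (H : ∀ N : Type, Nontrivial N → ∀ Q : Set (Fin k → N), FOTrue N (eI N) ψ →
      (∀ i, ExAllSem N Q (θ i) ↔ ExAllSem M R (θ i)) → D N Q) :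
    ∃ (ψ : EF) (_ : IsSentence ψ) (n n' : ℕ) (θ : Fin n → EF) (ξ : Fin n' → EF),
      (FOTrue M (eI M) ψ ∧ (∀ i, ExAllSem M R (θ i)) ∧
        (∀ j, ¬ ExAllSem M R (ξ j))) ∧
      (∀ (N : Type), Nontrivial N → ∀ Q : Set (Fin k → N),
        (FOTrue N (eI N) ψ ∧ (∀ i, ExAllSem N Q (θ i)) ∧
          (∀ j, ¬ ExAllSem N Q (ξ j))) → D N Q) := by
  obtain ⟨n, ⟨f⟩⟩ := Finite.exists_equiv_fin {i // ExAllSem M R (θ i)}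
  obtain ⟨n', ⟨g⟩⟩ := Finite.exists_equiv_fin {i // ¬ ExAllSem M R (θ i)}
  refine ⟨ψ, hψ, n, n', fun i => θ (f.symm i), fun j => θ (g.symm j),
    ⟨hψM, fun i => (f.symm i).2, fun j => (g.symm j).2⟩, ?_⟩
  rintro N hN Q ⟨hψN, hpos, hneg⟩
  refine H N hN Q hψN fun i => ?_
  by_cases hi : ExAllSem M R (θ i)
  · simpa [hi] using hpos (f ⟨i, hi⟩)
  · simpa [hi] using hneg (g ⟨i, hi⟩)

theorem HasPattern.exists_equiv {M N : Type} {k c : ℕ} {R : Set (Fin k → M)}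
    {Q : Set (Fin k → N)} (a : Fin c ≃ M)
    (hN : ∀ b : Fin c → N, Function.Injective b → Function.Surjective b)
    (h : HasPattern (paramType a '' R) Q) : ∃ e : M ≃ N, Q ⊆ (fun f => e ∘ f) '' R := by
  obtain ⟨b, hb, hbQ⟩ := h
  refine ⟨a.symm.trans (Equiv.ofBijective b ⟨hb, hN b hb⟩), fun y hy => ?_⟩
  obtain ⟨x, hx, hxy⟩ := hbQ y hy
  refine ⟨x, hx, funext fun i => ?_⟩
  exact (((paramType_eq_iff.1 hxy).1 i (a.symm (x i))).1 (by simp)).symm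

theorem exists_sentence_card_eq (c : ℕ) :
    ∃ ψ : EF, IsSentence ψ ∧ ∀ M : Type, Nonempty M →
      (FOTrue M (eI M) ψ ↔ Nonempty (Fin c ≃ M)) := by
  obtain ⟨ψ, hψ, h⟩ := exists_sentence_card_ge c
  obtain ⟨ψ', hψ', h'⟩ := exists_sentence_card_ge (c + 1)
  have hs : IsSentence (.and ψ (.cneg ψ') : EF) := by
    simp only [IsSentence, fv] at *
    simp [hψ, hψ']
  refine ⟨_, hs, fun M hM => ?_⟩
  have s : ℕ → M := fun _ => hM.some
  rw [FOTrue_iff_FSat _ hs s]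
  simp only [FSat]
  rw [← FOTrue_iff_FSat _ hψ, ← FOTrue_iff_FSat _ hψ', h M hM, h' M hM]
  constructor
  · rintro ⟨⟨a, ha⟩, hnot⟩
    refine ⟨Equiv.ofBijective a ⟨ha, fun m => ?_⟩⟩
    by_contra hm
    exact hnot ⟨Fin.cons m a, Fin.cons_injective_iff.2 ⟨hm, ha⟩⟩
  · rintro ⟨e⟩
    refine ⟨⟨e, e.injective⟩, fun ⟨a, ha⟩ => ?_⟩
    simpa using Fintype.card_le_of_injective _ (e.symm.injective.comp ha)

theorem eq_image_of_same_patterns {M N : Type} {k c : ℕ} {R : Set (Fin k → M)}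
    {Q : Set (Fin k → N)} (a : Fin c ≃ M) (b : Fin c ≃ N)
    (h : ∀ P : Set (Set (Fin k × Fin c) × Set (Fin k × Fin k)),
      HasPattern P Q ↔ HasPattern P R) : ∃ e : M ≃ N, Q = (fun f => e ∘ f) '' R := by
  have surj : ∀ {A : Type} (_ : Fin c ≃ A) (f : Fin c → A),
      Function.Injective f → Function.Surjective f := by
    intro A g f hf
    have : Finite A := Finite.of_equiv _ g
    exact (hf.bijective_of_nat_card_le (by simp [Nat.card_congr g.symm])).2
  have : Finite M := Finite.of_equiv _ a
  have : Finite N := Finite.of_equiv _ b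
  obtain ⟨e, he⟩ := ((h (paramType a '' R)).2 ⟨a, a.injective, fun x hx => ⟨x, hx, rfl⟩⟩).exists_equiv a (surj b)
  obtain ⟨e', he'⟩ := ((h (paramType b '' Q)).1 ⟨b, b.injective, fun x hx => ⟨x, hx, rfl⟩⟩).exists_equiv b (surj a)
  refine ⟨e, Set.eq_of_subset_of_ncard_le he ?_⟩
  exact (Set.ncard_image_le R.toFinite).trans
    ((Set.ncard_le_ncard he' (Set.toFinite _)).trans (Set.ncard_image_le Q.toFinite))

/-- If `D` is relativizable, both `D` and `∼D` are strongly first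
order, and `(M, R) ∈ D` with `M` countable, then there is a sentence
`η = ψ ∧ ⋀ᵢ ∃ȳᵢ ∀x̄ (R x̄ → θᵢ) ∧ ⋀ⱼ ¬∃z̄ⱼ ∀x̄ (R x̄ → ξⱼ)` (with `ψ, θᵢ, ξⱼ` over
the empty signature) true in `(M, R)` and entailing membership in `D`. -/
theorem eta_sentence_exists {k : ℕ} (D : DepPred k) (hiso : IsoClosed D)
    (hrel : Relativizable1 D) (hD : SFOd D) (hnD : SFOd (complD D))
    (M : Type) [Nontrivial M] [Countable M]
    (R : Set (Fin k → M)) (hR : D M R) :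
    ∃ (ψ : EF) (_ : IsSentence ψ) (n n' : ℕ) (θ : Fin n → EF) (ξ : Fin n' → EF),
      (FOTrue M (eI M) ψ ∧ (∀ i, ExAllSem M R (θ i)) ∧
        (∀ j, ¬ ExAllSem M R (ξ j))) ∧
      (∀ (N : Type), Nontrivial N → ∀ Q : Set (Fin k → N),
        (FOTrue N (eI N) ψ ∧ (∀ i, ExAllSem N Q (θ i)) ∧
          (∀ j, ¬ ExAllSem N Q (ξ j))) → D N Q) := by
  choose θ hθ using @exists_formula_hasPattern k
  have hM : Nonempty M := inferInstance
  rcases finite_or_infinite M with hfin | hinf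
  · obtain ⟨c, ⟨a⟩⟩ := Finite.exists_equiv_fin M
    obtain ⟨ψ, hψ, hψc⟩ := exists_sentence_card_eq c
    refine exists_eta_of_finite (@θ c) hψ ((hψc M hM).2 ⟨a.symm⟩) fun N _ Q hψN hQ => ?_
    have hN : Nonempty N := inferInstance
    obtain ⟨b⟩ := (hψc N hN).1 hψN
    obtain ⟨e, rfl⟩ := eq_image_of_same_patterns (R := R) (Q := Q) a.symm b fun P => by
      rw [← hθ P N Q ⟨b, b.injective⟩ hN, hQ, hθ P M R ⟨a.symm, a.symm.injective⟩ hM]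
    exact hiso M N e R hR
  · obtain ⟨e⟩ := nonempty_equiv_of_countable (α := M) (β := ℕ)
    obtain ⟨j, hj⟩ := exists_bound_of_same_patterns hiso hD hnD (hiso M ℕ e R hR)
    obtain ⟨ψ, hψ, hψj⟩ := exists_sentence_card_ge j
    have hMm : ∀ m, ∃ a : Fin m → M, Function.Injective a :=
      fun m => ⟨fun i => e.symm i, e.symm.injective.comp Fin.val_injective⟩
    refine exists_eta_of_finite
      (fun p : Σ m : Fin (j + 1), Set (Set (Fin k × Fin m) × Set (Fin k × Fin k)) => θ p.2)
      hψ ((hψj M hM).2 (hMm j)) fun N hN Q hψN hQ => ?_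
    have hN' : Nonempty N := inferInstance
    obtain ⟨a, ha⟩ := (hψj N hN').1 hψN
    refine hj N hN Q ⟨a, ha⟩ fun m hm P => ?_
    rw [hasPattern_image_equiv, ← hθ P N Q ⟨_, ha.comp (Fin.castLE_injective hm)⟩ hN',
      ← hθ P M R (hMm m) hM]
    exact hQ ⟨⟨m, by omega⟩, P⟩

end DSFO
end

section
/- For all first-order models 𝔐 with domain M, teams X over 𝔐, and first-order formulas θ(v̄, ȳ) over the empty signature with v̄ contained in the variables of the domain of X: 𝔐 ⊨_X ∃ȳ (const[ȳ] ∧ θ(v̄, ȳ)) if and only if (M, R := X(v̄)) ⊨ ∃ȳ ∀x̄ (R x̄ → θ(x̄, ȳ)). -/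
namespace DSFO

/-- Tarskian satisfaction only depends on the values of the free variables. -/
theorem fsat_congr {S : Signature} {ι : Type} {ar : ι → ℕ} {M : Type} (I : Interp S M)
    (φ : TS S ι ar) {s t : ℕ → M} (h : ∀ x ∈ fv φ, s x = t x) :
    FSat M I s φ ↔ FSat M I t φ := by
  induction φ generalizing s t with
  | rel r v | nrel r v =>
    have hv : (fun i => s (v i)) = fun i => t (v i) := funext fun i => h _ ⟨i, rfl⟩
    simp only [FSat, hv]
  | eq x y | neq x y =>
    simp only [FSat, h x (Or.inl rfl), h y (Or.inr rfl)]
  | dep i v => exact Iff.rfl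
  | and φ ψ ihφ ihψ | or φ ψ ihφ ihψ | gdisj φ ψ ihφ ihψ =>
    simp only [FSat, ihφ fun x hx => h x (Or.inl hx), ihψ fun x hx => h x (Or.inr hx)]
  | cneg φ ih => exact not_congr (ih h)
  | ex v φ ih | al v φ ih =>
    have key (m : M) : FSat M I (Function.update s v m) φ ↔
        FSat M I (Function.update t v m) φ := by
      refine ih fun x hx => ?_
      by_cases hxv : x = v
      · subst hxv; simp
      · simpa [hxv] using h x ⟨hx, hxv⟩
    simp only [FSat, key]

/-- First-order formulas are flat: a team satisfies them iff all its members do. -/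
theorem tsat_embedEF_iff {S : Signature} {ι : Type} {ar : ι → ℕ} {M : Type} (I : Interp S M)
    (A : ∀ i, Set (Fin (ar i) → M) → Prop) {θ : EF} (hθ : Plain θ) (X : Set (ℕ → M)) :
    TSat M I A (embedEF θ) X ↔ ∀ s ∈ X, FSat M (eI M) s θ := by
  induction θ generalizing X with
  | rel r v | nrel r v => exact r.elim
  | eq x y | neq x y => exact Iff.rfl
  | dep i v => exact i.elim
  | and φ ψ ihφ ihψ =>
    simp only [embedEF, TSat, FSat, ihφ ⟨hθ.1.1, hθ.2.1⟩, ihψ ⟨hθ.1.2, hθ.2.2⟩]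
    exact ⟨fun h s hs => ⟨h.1 s hs, h.2 s hs⟩,
      fun h => ⟨fun s hs => (h s hs).1, fun s hs => (h s hs).2⟩⟩
  | or φ ψ ihφ ihψ =>
    simp only [embedEF, TSat, FSat, ihφ ⟨hθ.1.1, hθ.2.1⟩, ihψ ⟨hθ.1.2, hθ.2.2⟩]
    constructor
    · rintro ⟨Y, Z, rfl, hY, hZ⟩ s (hs | hs)
      · exact Or.inl (hY s hs)
      · exact Or.inr (hZ s hs)
    · intro h
      refine ⟨{s ∈ X | FSat M (eI M) s φ}, {s ∈ X | FSat M (eI M) s ψ}, ?_,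
        fun s hs => hs.2, fun s hs => hs.2⟩
      ext s
      exact ⟨fun hs => hs.elim And.left And.left,
        fun hs => (h s hs).imp (fun h => ⟨hs, h⟩) fun h => ⟨hs, h⟩⟩
  | gdisj φ ψ => exact hθ.2.elim
  | cneg φ => exact hθ.1.elim
  | ex v φ ih =>
    simp only [embedEF, TSat, FSat, ih hθ]
    constructor
    · rintro ⟨H, hH, h⟩ s hs
      obtain ⟨m, hm⟩ := hH s hs
      exact ⟨m, h _ ⟨s, hs, m, hm, rfl⟩⟩
    · intro h
      refine ⟨fun s => {m | FSat M (eI M) (Function.update s v m) φ}, h, ?_⟩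
      rintro _ ⟨s, -, m, hm, rfl⟩
      exact hm
  | al v φ ih =>
    simp only [embedEF, TSat, FSat, ih hθ]
    constructor
    · exact fun h s hs m => h _ ⟨s, hs, m, rfl⟩
    · rintro h _ ⟨s, hs, m, rfl⟩
      exact h s hs m

/-- A team satisfying `∃ l φ` has an extension along `l` satisfying `φ`. -/
theorem exists_tsat_of_tsat_exs {S : Signature} {ι : Type} {ar : ι → ℕ} {M : Type}
    (I : Interp S M) (A : ∀ i, Set (Fin (ar i) → M) → Prop) (φ : TS S ι ar) (l : List ℕ)
    {X : Set (ℕ → M)} (h : TSat M I A (exs l φ) X) :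
    ∃ Y, TSat M I A φ Y ∧ ∀ s ∈ X, ∃ t ∈ Y, ∀ x ∉ l, t x = s x := by
  induction l generalizing X with
  | nil => exact ⟨X, h, fun s hs => ⟨s, hs, fun _ _ => rfl⟩⟩
  | cons a l ih =>
    obtain ⟨H, hH, h⟩ := h
    obtain ⟨Y, hY, hXY⟩ := ih h
    refine ⟨Y, hY, fun s hs => ?_⟩
    obtain ⟨m, hm⟩ := hH s hs
    obtain ⟨t, ht, hst⟩ := hXY _ ⟨s, hs, m, hm, rfl⟩
    refine ⟨t, ht, fun x hx => ?_⟩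
    rw [List.mem_cons, not_or] at hx
    rw [hst x hx.2, Function.update_of_ne hx.1]

/-- The variables in `l` may be witnessed by the constant values given by `g`. -/
theorem tsat_exs_of_tsat_image {S : Signature} {ι : Type} {ar : ι → ℕ} {M : Type}
    (I : Interp S M) (A : ∀ i, Set (Fin (ar i) → M) → Prop) (φ : TS S ι ar) (g : ℕ → M)
    (l : List ℕ) {X : Set (ℕ → M)}
    (h : TSat M I A φ ((fun s x => if x ∈ l then g x else s x) '' X)) :
    TSat M I A (exs l φ) X := by
  induction l generalizing X with
  | nil => simpa [exs] using h
  | cons a l ih =>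
    refine ⟨fun _ => {g a}, fun _ _ => Set.singleton_nonempty _, ih ?_⟩
    convert h using 1
    have hupd (s : ℕ → M) : (fun x => if x ∈ l then g x else Function.update s a (g a) x) =
        fun x => if x ∈ a :: l then g x else s x := by
      ext x
      by_cases hx : x = a
      · subst hx; simp
      · simp [hx]
    ext t
    constructor
    · rintro ⟨_, ⟨s, hs, _, rfl, rfl⟩, rfl⟩
      exact ⟨s, hs, (hupd s).symm⟩
    · rintro ⟨s, hs, rfl⟩
      exact ⟨_, ⟨s, hs, _, rfl, rfl⟩, hupd s⟩

/-- `𝔐 ⊨_X ∃ȳ (const[ȳ] ∧ θ(v̄, ȳ))` iff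
`(M, R := X(v̄)) ⊨ ∃ȳ ∀x̄ (R x̄ → θ(x̄, ȳ))`, for `θ` a first-order formula over
the empty signature (in negation normal form). -/
theorem const_exists_theta_lemma (S : Signature) (M : Type) [Nontrivial M]
    (I : Interp S M) {k n : ℕ} (v : Fin k → ℕ) (y : Fin n → ℕ)
    (hy : Function.Injective y) (hvy : ∀ i j, y i ≠ v j)
    (θ : EF) (hθ : Plain θ) (hfv : fv θ ⊆ Set.range v ∪ Set.range y)
    (X : Set (ℕ → M)) :
    TSat M I (cSem M)
        (exs (List.ofFn y) (TS.and (TS.dep (CIdx.const n) y) (embedEF θ))) X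
    ↔ projExAll v y θ (teamProj v X) := by
  constructor
  · intro h
    obtain ⟨Y, ⟨hc, hY⟩, hXY⟩ := exists_tsat_of_tsat_exs I (cSem M) _ _ h
    rw [tsat_embedEF_iff I (cSem M) hθ] at hY
    obtain ⟨b, hb⟩ : ∃ b : Fin n → M, ∀ t ∈ Y, ∀ i, t (y i) = b i := by
      rcases Y.eq_empty_or_nonempty with rfl | ⟨t₀, ht₀⟩
      · exact ⟨fun _ => Classical.arbitrary M, fun t ht => ht.elim⟩
      · exact ⟨fun i => t₀ (y i), fun t ht => congrFun (hc _ ⟨t, ht, rfl⟩ _ ⟨t₀, ht₀, rfl⟩)⟩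
    refine ⟨b, ?_⟩
    rintro _ ⟨s, hs, rfl⟩ u huv huy
    obtain ⟨t, ht, hst⟩ := hXY s hs
    refine (fsat_congr (eI M) θ fun x hx => ?_).1 (hY t ht)
    rcases hfv hx with ⟨j, rfl⟩ | ⟨i, rfl⟩
    · rw [huv, hst]
      simpa [List.mem_ofFn] using fun i => hvy i j
    · rw [huy, hb t ht]
  · rintro ⟨b, hb⟩
    let g : ℕ → M := Function.extend y b fun _ => Classical.arbitrary M
    have hg (i : Fin n) : g (y i) = b i := hy.extend_apply _ _ i
    refine tsat_exs_of_tsat_image I (cSem M) _ g _ ⟨?_, ?_⟩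
    · rintro _ ⟨_, ⟨s, -, rfl⟩, rfl⟩ _ ⟨_, ⟨t, -, rfl⟩, rfl⟩
      funext (i : Fin n)
      simp [List.mem_ofFn]
    · rw [tsat_embedEF_iff I (cSem M) hθ]
      rintro _ ⟨s, hs, rfl⟩
      refine hb _ ⟨s, hs, rfl⟩ _ (fun j => ?_) fun i => ?_
      · simp [List.mem_ofFn, hvy]
      · simp [List.mem_ofFn, hg]

end DSFO
end
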